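/- arXiv:1509.05752 — 2 statements merged into one kernel-verified Lean document; each statement's English description precedes it below -/
import Mathlib

section
/- For every integer r ≥ 2 there exists a constant C > 0 such that for all n ≥ 3, all α, β > 0 with a = 1/α and b = 1/β, and all 1 ≤ j_1 < ⋯ < j_r ≤ n−2 for which j_{l+1} ≤ j_l + 2 holds for at least one l ∈ {1, …, r−1}, the probability under ℙ_{n,α,β} that, for every l = 1, …, r, the box (n−j_l−1, j_l) is nonempty is at most C/(n+a+b)^r. -/
open scoped BigOperators

/-- A symbol in an α/β-staircase tableau: empty, α, or β. -/
inductive StairSymb : Type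
  | empty : StairSymb
  | alpha : StairSymb
  | beta  : StairSymb
  deriving DecidableEq

/-- `S` is an α/β-staircase tableau of size `n` (1-based indexing; boxes are the
pairs `(i,j)` with `1 ≤ i`, `1 ≤ j`, `i + j ≤ n + 1`; outside the boxes `S` is empty). -/
def IsStaircase (n : ℕ) (S : ℕ → ℕ → StairSymb) : Prop :=
  (∀ i j, ¬(1 ≤ i ∧ 1 ≤ j ∧ i + j ≤ n + 1) → S i j = StairSymb.empty) ∧
  (∀ i i' j, 1 ≤ i → i < i' → 1 ≤ j → i' + j ≤ n + 1 →
    S i' j = StairSymb.alpha → S i j = StairSymb.empty) ∧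
  (∀ i j j', 1 ≤ i → 1 ≤ j → j < j' → i + j' ≤ n + 1 →
    S i j' = StairSymb.beta → S i j = StairSymb.empty) ∧
  (∀ i j, 1 ≤ i → 1 ≤ j → i + j = n + 1 → S i j ≠ StairSymb.empty)

/-- The weight `wt(S) = α^{N_α(S)} β^{N_β(S)}` of a tableau. -/
noncomputable def stairWt (α β : ℝ) (S : ℕ → ℕ → StairSymb) : ℝ :=
  α ^ Set.ncard {p : ℕ × ℕ | S p.1 p.2 = StairSymb.alpha} *
  β ^ Set.ncard {p : ℕ × ℕ | S p.1 p.2 = StairSymb.beta}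

/-- The partition function `Z_n(α,β)`, the total weight of all tableaux of size `n`. -/
noncomputable def stairZ (n : ℕ) (α β : ℝ) : ℝ :=
  ∑ᶠ S ∈ {S : ℕ → ℕ → StairSymb | IsStaircase n S}, stairWt α β S

/-- The probability `ℙ_{n,α,β}(E)` of an event `E` (a set of tableaux of size `n`). -/
noncomputable def stairP (n : ℕ) (α β : ℝ) (E : (ℕ → ℕ → StairSymb) → Prop) : ℝ :=
  (∑ᶠ S ∈ {S : ℕ → ℕ → StairSymb | IsStaircase n S ∧ E S}, stairWt α β S) / stairZ n α β

/-- The expectation `E_{n,α,β}[f]` of a real function of the random tableau. -/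
noncomputable def stairE (n : ℕ) (α β : ℝ) (f : (ℕ → ℕ → StairSymb) → ℝ) : ℝ :=
  (∑ᶠ S ∈ {S : ℕ → ℕ → StairSymb | IsStaircase n S}, f S * stairWt α β S) / stairZ n α β

open Classical in
/-- The columns supported on the rows of `F` in `[1, m]`, with nothing above an `α`. -/
noncomputable def partialCols (F : Set ℕ) : ℕ → Finset (ℕ → StairSymb)
  | 0 => {fun _ => StairSymb.empty}
  | m + 1 => partialCols F m ∪
      if m + 1 ∈ F then
        (partialCols F m).image (fun c => Function.update c (m + 1) StairSymb.beta) ∪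
          {Function.update (fun _ => StairSymb.empty) (m + 1) StairSymb.alpha}
      else ∅

open Classical in
/-- The columns with nonempty bottom box in row `m + 1` that are supported, above that box, on the
rows of `F`. -/
noncomputable def fullCols (F : Set ℕ) (m : ℕ) : Finset (ℕ → StairSymb) :=
  (partialCols F m).image (fun c => Function.update c (m + 1) StairSymb.beta) ∪
    {Function.update (fun _ => StairSymb.empty) (m + 1) StairSymb.alpha}

open Classical in
lemma partialCols_succ_of_mem {F : Set ℕ} {m : ℕ} (h : m + 1 ∈ F) :
    partialCols F (m + 1) = partialCols F m ∪ fullCols F m := by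
  rw [partialCols, if_pos h, fullCols]

lemma partialCols_succ_of_notMem {F : Set ℕ} {m : ℕ} (h : m + 1 ∉ F) :
    partialCols F (m + 1) = partialCols F m := by
  simp [partialCols, h]

open Classical in
lemma mem_partialCols {F : Set ℕ} {m : ℕ} {c : ℕ → StairSymb} :
    c ∈ partialCols F m ↔
      (∀ i, c i ≠ StairSymb.empty → 1 ≤ i ∧ i ≤ m ∧ i ∈ F) ∧
      ∀ i i', i < i' → c i' = StairSymb.alpha → c i = StairSymb.empty := by
  induction m generalizing c with
  | zero =>
    simp only [partialCols, Finset.mem_singleton]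
    constructor
    · rintro rfl; simp
    · rintro ⟨h, -⟩
      funext i
      by_contra hi
      have := h i hi
      omega
  | succ m ih =>
    by_cases hm : m + 1 ∈ F
    · rw [partialCols_succ_of_mem hm]
      simp only [fullCols, Finset.mem_union, Finset.mem_image, Finset.mem_singleton, ih]
      constructor
      · rintro (⟨h1, h2⟩ | ⟨d, ⟨h1, h2⟩, rfl⟩ | rfl)
        · exact ⟨fun i hi => ⟨(h1 i hi).1, (h1 i hi).2.1.trans (Nat.le_succ m), (h1 i hi).2.2⟩, h2⟩
        · constructor
          · intro i hi
            by_cases h : i = m + 1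
            · subst h; exact ⟨by omega, le_rfl, hm⟩
            · rw [Function.update_of_ne h] at hi
              exact ⟨(h1 i hi).1, (h1 i hi).2.1.trans (Nat.le_succ m), (h1 i hi).2.2⟩
          · intro i i' hii hi'
            by_cases h : i' = m + 1
            · subst h; simp at hi'
            · rw [Function.update_of_ne h] at hi'
              have := (h1 i' (by simp [hi'])).2.1
              rw [Function.update_of_ne (by omega)]
              exact h2 i i' hii hi'
        · constructor
          · intro i hi
            by_cases h : i = m + 1
            · subst h; exact ⟨by omega, le_rfl, hm⟩
            · simp [Function.update_of_ne h] at hi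
          · intro i i' hii hi'
            by_cases h : i' = m + 1
            · rw [Function.update_of_ne (by omega)]
            · simp [Function.update_of_ne h] at hi'
      · rintro ⟨h1, h2⟩
        cases hc : c (m + 1) with
        | empty =>
          left
          refine ⟨fun i hi => ?_, h2⟩
          have := h1 i hi
          have : i ≠ m + 1 := by rintro rfl; exact hi hc
          exact ⟨(h1 i hi).1, by omega, (h1 i hi).2.2⟩
        | beta =>
          right; left
          refine ⟨Function.update c (m + 1) StairSymb.empty, ⟨fun i hi => ?_, ?_⟩, ?_⟩
          · by_cases h : i = m + 1
            · subst h; simp at hi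
            · rw [Function.update_of_ne h] at hi
              have := h1 i hi
              exact ⟨this.1, by omega, this.2.2⟩
          · intro i i' hii hi'
            by_cases h : i = m + 1
            · subst h; simp
            · rw [Function.update_of_ne h]
              by_cases h' : i' = m + 1
              · subst h'; simp at hi'
              · rw [Function.update_of_ne h'] at hi'
                exact h2 i i' hii hi'
          · rw [Function.update_idem, ← hc, Function.update_eq_self]
        | alpha =>
          right; right
          funext i
          by_cases h : i = m + 1
          · subst h; simp [hc]
          · rw [Function.update_of_ne h]
            by_contra hi
            have := h1 i hi
            exact hi (h2 i (m + 1) (by omega) hc)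
    · rw [partialCols_succ_of_notMem hm, ih]
      refine and_congr_left fun _ => forall_congr' fun i => forall_congr' fun _ => ?_
      constructor
      · rintro ⟨h1, h2, h3⟩; exact ⟨h1, by omega, h3⟩
      · rintro ⟨h1, h2, h3⟩
        have : i ≠ m + 1 := by rintro rfl; exact hm h3
        exact ⟨h1, by omega, h3⟩

lemma eq_empty_of_mem_partialCols {F : Set ℕ} {m : ℕ} {c : ℕ → StairSymb}
    (hc : c ∈ partialCols F m) {i : ℕ} (hi : m < i) : c i = StairSymb.empty := by
  by_contra h
  have := (mem_partialCols.1 hc).1 i h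
  omega

open Classical in
lemma mem_fullCols {F : Set ℕ} {m : ℕ} (hm : m + 1 ∈ F) {c : ℕ → StairSymb} :
    c ∈ fullCols F m ↔ c ∈ partialCols F (m + 1) ∧ c (m + 1) ≠ StairSymb.empty := by
  rw [partialCols_succ_of_mem hm, Finset.mem_union]
  constructor
  · intro h
    refine ⟨Or.inr h, ?_⟩
    simp only [fullCols, Finset.mem_union, Finset.mem_image, Finset.mem_singleton] at h
    rcases h with ⟨d, -, rfl⟩ | rfl <;> simp
  · rintro ⟨h | h, h'⟩
    · exact absurd (eq_empty_of_mem_partialCols h (Nat.lt_succ_self m)) h'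
    · exact h

lemma sum_fullCols (F : Set ℕ) (m : ℕ) (g : (ℕ → StairSymb) → ℝ) :
    ∑ c ∈ fullCols F m, g c =
      ∑ c ∈ partialCols F m, g (Function.update c (m + 1) StairSymb.beta) +
        g (Function.update (fun _ => StairSymb.empty) (m + 1) StairSymb.alpha) := by
  classical
  rw [fullCols, Finset.sum_union, Finset.sum_singleton, Finset.sum_image]
  · intro c hc d hd hcd
    funext i
    by_cases hi : i = m + 1
    · subst hi
      rw [eq_empty_of_mem_partialCols hc (Nat.lt_succ_self m),
        eq_empty_of_mem_partialCols hd (Nat.lt_succ_self m)]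
    · simpa [Function.update_of_ne hi] using congrFun hcd i
  · rw [Finset.disjoint_singleton_right, Finset.mem_image]
    rintro ⟨c, -, hc⟩
    simpa using congrFun hc (m + 1)

lemma sum_partialCols_succ_of_mem {F : Set ℕ} {m : ℕ} (h : m + 1 ∈ F)
    (g : (ℕ → StairSymb) → ℝ) :
    ∑ c ∈ partialCols F (m + 1), g c =
      ∑ c ∈ partialCols F m, g c + ∑ c ∈ fullCols F m, g c := by
  classical
  rw [partialCols_succ_of_mem h, Finset.sum_union]
  rw [Finset.disjoint_left]
  intro c hc hc'
  exact ((mem_fullCols h).1 hc').2 (eq_empty_of_mem_partialCols hc (Nat.lt_succ_self m))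

open Classical in
/-- The number of elements of `F` in `[1, m]`. -/
noncomputable def freeCount (F : Set ℕ) (m : ℕ) : ℕ := ((Finset.Icc 1 m).filter (· ∈ F)).card

open Classical in
lemma freeCount_succ (F : Set ℕ) (m : ℕ) :
    freeCount F (m + 1) = freeCount F m + if m + 1 ∈ F then 1 else 0 := by
  rw [freeCount, freeCount, ← Finset.insert_Icc_right_eq_Icc_add_one (by omega), Finset.filter_insert]
  split_ifs <;> simp

lemma freeCount_congr {F G : Set ℕ} {m : ℕ} (h : ∀ i, 1 ≤ i → i ≤ m → (i ∈ F ↔ i ∈ G)) :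
    freeCount F m = freeCount G m := by
  classical
  unfold freeCount
  congr 1
  refine Finset.filter_congr fun i hi => ?_
  rw [Finset.mem_Icc] at hi
  exact h i hi.1 hi.2

/-- The weight of a column, times `X` to the number of rows of `F` in `[1, m]` in which the column
has no `β`. -/
noncomputable def colWt (α β X : ℝ) (F : Set ℕ) (m : ℕ) (c : ℕ → StairSymb) : ℝ :=
  α ^ Set.ncard {i | c i = StairSymb.alpha} * β ^ Set.ncard {i | c i = StairSymb.beta} *
    X ^ freeCount {i | i ∈ F ∧ c i ≠ StairSymb.beta} m

open Classical in
lemma colWt_succ (α β X : ℝ) {F : Set ℕ} {m : ℕ} {c : ℕ → StairSymb}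
    (hc : c ∈ partialCols F m) :
    colWt α β X F (m + 1) c = (if m + 1 ∈ F then X else 1) * colWt α β X F m c := by
  have := eq_empty_of_mem_partialCols hc (Nat.lt_succ_self m)
  simp only [colWt, freeCount_succ, Set.mem_ofPred_eq, this]
  split_ifs with h1 h2 h2
  · ring
  · simp_all
  · simp_all
  · ring

lemma colWt_update_beta (α β X : ℝ) {F : Set ℕ} {m : ℕ} {c : ℕ → StairSymb}
    (hc : c ∈ partialCols F m) :
    colWt α β X F (m + 1) (Function.update c (m + 1) StairSymb.beta) =
      β * colWt α β X F m c := by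
  have he := eq_empty_of_mem_partialCols hc (Nat.lt_succ_self m)
  have h1 : {i | Function.update c (m + 1) StairSymb.beta i = StairSymb.alpha} =
      {i | c i = StairSymb.alpha} := by
    ext i
    by_cases hi : i = m + 1
    · subst hi; simp [he]
    · simp [Function.update_of_ne hi]
  have h2 : {i | Function.update c (m + 1) StairSymb.beta i = StairSymb.beta} =
      insert (m + 1) {i | c i = StairSymb.beta} := by
    ext i
    by_cases hi : i = m + 1
    · subst hi; simp
    · simp [hi]
  have hfin : {i | c i = StairSymb.beta}.Finite := by
    refine (Set.finite_Iic m).subset fun i hi => ?_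
    simp only [Set.mem_ofPred_eq] at hi
    exact ((mem_partialCols.1 hc).1 i (by simp [hi])).2.1
  have h3 : freeCount {i | i ∈ F ∧ Function.update c (m + 1) StairSymb.beta i ≠ StairSymb.beta}
      (m + 1) = freeCount {i | i ∈ F ∧ c i ≠ StairSymb.beta} m := by
    classical
    rw [freeCount_succ, if_neg (by simp), add_zero]
    refine freeCount_congr fun i _ hi => ?_
    simp [Function.update_of_ne (show i ≠ m + 1 by omega)]
  rw [colWt, h1, h2, h3, Set.ncard_insert_of_notMem (by simp [he]) hfin, colWt]
  ring

lemma colWt_update_alpha (α β X : ℝ) {F : Set ℕ} {m : ℕ} (hm : m + 1 ∈ F) :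
    colWt α β X F (m + 1)
      (Function.update (fun _ => StairSymb.empty) (m + 1) StairSymb.alpha) =
      α * X * X ^ freeCount F m := by
  have h1 : {i | Function.update (fun _ => StairSymb.empty) (m + 1) StairSymb.alpha i =
      StairSymb.alpha} = {m + 1} := by
    ext i
    by_cases hi : i = m + 1
    · subst hi; simp
    · simp [hi]
  have h2 : {i | Function.update (fun _ => StairSymb.empty) (m + 1) StairSymb.alpha i =
      StairSymb.beta} = ∅ := by
    ext i
    by_cases hi : i = m + 1
    · subst hi; simp
    · simp [Function.update_of_ne hi]
  have h3 : freeCount {i | i ∈ F ∧ Function.update (fun _ => StairSymb.empty) (m + 1)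
      StairSymb.alpha i ≠ StairSymb.beta} (m + 1) = freeCount F m + 1 := by
    classical
    rw [freeCount_succ, if_pos (by simp [hm])]
    congr 1
    refine freeCount_congr fun i _ hi => ?_
    simp [Function.update_of_ne (show i ≠ m + 1 by omega)]
  rw [colWt, h1, h2, h3]
  simp
  ring

lemma sum_colWt_partialCols (α β X : ℝ) (F : Set ℕ) (m : ℕ) :
    β * ∑ c ∈ partialCols F m, colWt α β X F m c =
      (α * X + β) * (X + β) ^ freeCount F m - α * X * X ^ freeCount F m := by
  classical
  induction m with
  | zero => simp [partialCols, colWt, freeCount]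
  | succ m ih =>
    have h0 : ∑ c ∈ partialCols F m, colWt α β X F (m + 1) c =
        (if m + 1 ∈ F then X else 1) * ∑ c ∈ partialCols F m, colWt α β X F m c := by
      rw [Finset.mul_sum]
      exact Finset.sum_congr rfl fun c hc => colWt_succ α β X hc
    by_cases hm : m + 1 ∈ F
    · have h1 : ∑ c ∈ partialCols F m,
          colWt α β X F (m + 1) (Function.update c (m + 1) StairSymb.beta) =
          β * ∑ c ∈ partialCols F m, colWt α β X F m c := by
        rw [Finset.mul_sum]
        exact Finset.sum_congr rfl fun c hc => colWt_update_beta α β X hc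
      rw [sum_partialCols_succ_of_mem hm, sum_fullCols, h0, h1, colWt_update_alpha α β X hm,
        freeCount_succ, if_pos hm, if_pos hm]
      linear_combination (X + β) * ih
    · rw [partialCols_succ_of_notMem hm, h0, freeCount_succ, if_neg hm, if_neg hm, one_mul,
        add_zero, ih]

lemma sum_colWt_fullCols (α β X : ℝ) {F : Set ℕ} {m : ℕ} (hm : m + 1 ∈ F) :
    ∑ c ∈ fullCols F m, colWt α β X F (m + 1) c = (α * X + β) * (X + β) ^ freeCount F m := by
  rw [sum_fullCols, colWt_update_alpha α β X hm,
    Finset.sum_congr rfl fun c hc => colWt_update_beta α β X hc, ← Finset.mul_sum,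
    sum_colWt_partialCols]
  ring

open Classical in
lemma sum_colWt_fullCols_alpha (α β X : ℝ) {F : Set ℕ} {m : ℕ} (hm : m + 1 ∈ F) :
    ∑ c ∈ fullCols F m with c (m + 1) = StairSymb.alpha, colWt α β X F (m + 1) c =
      α * X * X ^ freeCount F m := by
  rw [Finset.sum_filter, sum_fullCols]
  simp [colWt_update_alpha α β X hm]

lemma colWt_nonneg {α β X : ℝ} (hα : 0 < α) (hβ : 0 < β) (hX : 0 < X) (F : Set ℕ) (m : ℕ)
    (c : ℕ → StairSymb) : 0 ≤ colWt α β X F m c := by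
  unfold colWt; positivity

open Classical in
lemma sum_colWt_fullCols_third_le {α β X : ℝ} (hα : 0 < α) (hβ : 0 < β) (hX : 0 < X)
    (F : Set ℕ) (m : ℕ) :
    ∑ c ∈ fullCols F (m + 2) with c (m + 1) ≠ StairSymb.empty, colWt α β X F (m + 3) c ≤
      β / (X + β) * (α * X + β) * (X + β) ^ freeCount F (m + 2) := by
  set g : (ℕ → StairSymb) → ℕ → ℝ := fun c k =>
    if c (m + 1) ≠ StairSymb.empty then colWt α β X F k c else 0 with hg
  have hub : ∀ (c : ℕ → StairSymb) (k : ℕ), m + 1 ≤ k → c ∈ partialCols F k →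
      g (Function.update c (k + 1) StairSymb.beta) (k + 1) = β * g c k := by
    intro c k hk hc
    simp only [hg, Function.update_of_ne (show m + 1 ≠ k + 1 by omega),
      colWt_update_beta α β X hc, mul_ite, mul_zero]
  have hua : ∀ k : ℕ, m + 1 ≤ k →
      g (Function.update (fun _ => StairSymb.empty) (k + 1) StairSymb.alpha) (k + 1) = 0 := by
    intro k hk
    simp [hg, Function.update_of_ne (show m + 1 ≠ k + 1 by omega)]
  have hfull : ∀ k, m + 1 ≤ k → ∑ c ∈ fullCols F k, g c (k + 1) =
      β * ∑ c ∈ partialCols F k, g c k := by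
    intro k hk
    rw [sum_fullCols, hua k hk, add_zero, Finset.mul_sum]
    exact Finset.sum_congr rfl fun c hc => hub c k hk hc
  have h1 : ∑ c ∈ partialCols F (m + 1), g c (m + 1) =
      if m + 1 ∈ F then (α * X + β) * (X + β) ^ freeCount F m else 0 := by
    have hz : ∑ c ∈ partialCols F m, g c (m + 1) = 0 := by
      refine Finset.sum_eq_zero fun c hc => ?_
      simp [hg, eq_empty_of_mem_partialCols hc (Nat.lt_succ_self m)]
    split_ifs with h
    · rw [sum_partialCols_succ_of_mem h, hz, zero_add, ← sum_colWt_fullCols α β X h]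
      refine Finset.sum_congr rfl fun c hc => ?_
      simp [hg, ((mem_fullCols h).1 hc).2]
    · rw [partialCols_succ_of_notMem h, hz]
  have h2 : ∑ c ∈ partialCols F (m + 2), g c (m + 2) =
      (if m + 2 ∈ F then X + β else 1) * ∑ c ∈ partialCols F (m + 1), g c (m + 1) := by
    have hz : ∑ c ∈ partialCols F (m + 1), g c (m + 2) =
        (if m + 2 ∈ F then X else 1) * ∑ c ∈ partialCols F (m + 1), g c (m + 1) := by
      rw [Finset.mul_sum]
      refine Finset.sum_congr rfl fun c hc => ?_
      simp only [hg, colWt_succ α β X hc]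
      split_ifs <;> simp
    split_ifs with h
    · rw [sum_partialCols_succ_of_mem h, hz, hfull (m + 1) le_rfl, if_pos h]
      ring
    · rw [partialCols_succ_of_notMem h, hz, if_neg h]
  rw [Finset.sum_filter]
  change ∑ c ∈ fullCols F (m + 2), g c (m + 3) ≤ _
  rw [hfull (m + 2) (by omega), h2, h1, freeCount_succ, freeCount_succ]
  have hXβ : X + β ≠ 0 := by positivity
  split_ifs with ha hb hb
  · refine le_of_eq ?_
    field_simp
    ring
  · simp only [mul_zero]
    positivity
  · refine le_of_eq ?_
    field_simp
    ring
  · simp only [mul_zero]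
    positivity

/-- The tableau with first column `c` and remaining columns those of `S`. -/
def consCol (c : ℕ → StairSymb) (S : ℕ → ℕ → StairSymb) : ℕ → ℕ → StairSymb
  | _, 0 => StairSymb.empty
  | i, 1 => c i
  | i, j + 2 => S i (j + 1)

/-- The rows of `S` containing no `β`. -/
def freeRows (S : ℕ → ℕ → StairSymb) : Set ℕ := {i | ∀ j, S i j ≠ StairSymb.beta}

open Classical in
/-- The finite set of α/β-staircase tableaux of size `n`. -/
noncomputable def staircases : ℕ → Finset (ℕ → ℕ → StairSymb)
  | 0 => {fun _ _ => StairSymb.empty}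
  | n + 1 => (staircases n).biUnion fun S =>
      (fullCols (freeRows S) n).image fun c => consCol c S

lemma IsStaircase.succ_mem_freeRows {n : ℕ} {S : ℕ → ℕ → StairSymb} (hS : IsStaircase n S) :
    n + 1 ∈ freeRows S := by
  intro j hj
  have := hS.1 (n + 1) j (by omega)
  simp [hj] at this

lemma IsStaircase.consCol {n : ℕ} {S : ℕ → ℕ → StairSymb} (hS : IsStaircase n S)
    {c : ℕ → StairSymb} (hc : c ∈ fullCols (freeRows S) n) :
    IsStaircase (n + 1) (consCol c S) := by
  obtain ⟨hc, hb⟩ := (mem_fullCols hS.succ_mem_freeRows).1 hc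
  obtain ⟨hc1, hc2⟩ := mem_partialCols.1 hc
  obtain ⟨h1, h2, h3, h4⟩ := hS
  refine ⟨?_, ?_, ?_, ?_⟩
  · rintro i (_ | _ | j) h
    · rfl
    · by_contra hi
      have := hc1 i hi
      omega
    · exact h1 i (j + 1) (by omega)
  · rintro i i' (_ | _ | j) hi hii _ hj h
    · rfl
    · exact hc2 i i' hii h
    · exact h2 i i' (j + 1) hi hii (by omega) (by omega) h
  · rintro i (_ | _ | j) (_ | _ | j') hi _ hjj hj h
    · rfl
    · rfl
    · rfl
    · omega
    · omega
    · by_contra hi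
      exact (hc1 i hi).2.2 (j' + 1) h
    · omega
    · omega
    · exact h3 i (j + 1) (j' + 1) hi (by omega) (by omega) (by omega) h
  · rintro i (_ | _ | j) hi hj hij
    · omega
    · obtain rfl : i = n + 1 := by omega
      exact hb
    · exact h4 i (j + 1) hi (by omega) (by omega)

lemma IsStaircase.exists_consCol {n : ℕ} {T : ℕ → ℕ → StairSymb} (hT : IsStaircase (n + 1) T) :
    ∃ S, IsStaircase n S ∧ ∃ c ∈ fullCols (freeRows S) n, _root_.consCol c S = T := by
  obtain ⟨h1, h2, h3, h4⟩ := hT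
  have hS : IsStaircase n (fun i j => if j = 0 then StairSymb.empty else T i (j + 1)) := by
    refine ⟨?_, ?_, ?_, ?_⟩
    · intro i j h
      dsimp only
      split_ifs with hj
      · rfl
      · exact h1 i (j + 1) (by omega)
    · intro i i' j hi hii hj hn
      simp only [if_neg (show j ≠ 0 by omega)]
      exact h2 i i' (j + 1) hi hii (by omega) (by omega)
    · intro i j j' hi hj hjj hn
      simp only [if_neg (show j ≠ 0 by omega), if_neg (show j' ≠ 0 by omega)]
      exact h3 i (j + 1) (j' + 1) hi (by omega) (by omega) (by omega)
    · intro i j hi hj hij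
      simp only [if_neg (show j ≠ 0 by omega)]
      exact h4 i (j + 1) hi (by omega) (by omega)
  refine ⟨_, hS, fun i => T i 1, ?_, ?_⟩
  · rw [mem_fullCols hS.succ_mem_freeRows, mem_partialCols]
    have hsupp : ∀ i j, T i j ≠ StairSymb.empty → 1 ≤ i ∧ 1 ≤ j ∧ i + j ≤ n + 1 + 1 := by
      intro i j h
      by_contra hi
      exact h (h1 i j hi)
    refine ⟨⟨fun i hi => ?_, fun i i' hii hi' => ?_⟩, h4 (n + 1) 1 (by omega) le_rfl rfl⟩
    · have := hsupp i 1 hi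
      refine ⟨this.1, by omega, fun j hj => ?_⟩
      by_cases hj0 : j = 0
      · simp [hj0] at hj
      · simp only [if_neg hj0] at hj
        have := hsupp i (j + 1) (by simp [hj])
        exact hi (h3 i 1 (j + 1) this.1 le_rfl (by omega) (by omega) hj)
    · have := hsupp i' 1 (by simp [hi'])
      by_cases hi0 : 1 ≤ i
      · exact h2 i i' 1 hi0 hii le_rfl (by omega) hi'
      · exact h1 i 1 (by omega)
  · funext i j
    match j with
    | 0 => exact (h1 i 0 (by omega)).symm
    | 1 => rfl
    | j + 2 => rfl

lemma mem_staircases {n : ℕ} {S : ℕ → ℕ → StairSymb} : S ∈ staircases n ↔ IsStaircase n S := by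
  induction n generalizing S with
  | zero =>
    simp only [staircases, Finset.mem_singleton]
    constructor
    · rintro rfl
      refine ⟨fun _ _ _ => rfl, fun _ _ _ _ _ _ _ _ => rfl, fun _ _ _ _ _ _ _ _ => rfl, ?_⟩
      intro i j hi hj hij
      omega
    · intro h
      funext i j
      exact h.1 i j (by omega)
  | succ n ih =>
    simp only [staircases, Finset.mem_biUnion, Finset.mem_image, ih]
    constructor
    · rintro ⟨S, hS, c, hc, rfl⟩
      exact hS.consCol hc
    · exact IsStaircase.exists_consCol

lemma IsStaircase.apply_zero {n : ℕ} {S : ℕ → ℕ → StairSymb} (hS : IsStaircase n S) (i : ℕ) :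
    S i 0 = StairSymb.empty :=
  hS.1 i 0 (by omega)

lemma sum_staircases_succ (n : ℕ) (g : (ℕ → ℕ → StairSymb) → ℝ) :
    ∑ S ∈ staircases (n + 1), g S =
      ∑ S ∈ staircases n, ∑ c ∈ fullCols (freeRows S) n, g (consCol c S) := by
  classical
  rw [staircases, Finset.sum_biUnion]
  · refine Finset.sum_congr rfl fun S _ => Finset.sum_image fun c _ d _ h => ?_
    funext i
    exact congrFun (congrFun h i) 1
  · intro S hS S' hS' hne
    rw [Function.onFun, Finset.disjoint_left]
    intro T hT hT'
    obtain ⟨c, -, rfl⟩ := Finset.mem_image.1 hT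
    obtain ⟨d, -, h⟩ := Finset.mem_image.1 hT'
    refine hne ?_
    funext i j
    match j with
    | 0 => rw [(mem_staircases.1 hS).apply_zero, (mem_staircases.1 hS').apply_zero]
    | j + 1 => exact (congrFun (congrFun h i) (j + 2)).symm

lemma IsStaircase.finite_ne_empty {n : ℕ} {S : ℕ → ℕ → StairSymb} (hS : IsStaircase n S) :
    {p : ℕ × ℕ | S p.1 p.2 ≠ StairSymb.empty}.Finite := by
  refine (Set.finite_Iic ((n + 1, n + 1) : ℕ × ℕ)).subset fun p hp => ?_
  by_contra h
  refine hp (hS.1 _ _ fun h' => h ?_)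
  rw [Set.mem_Iic, Prod.le_def]
  constructor <;> dsimp only <;> omega

lemma ncard_consCol {n : ℕ} {S : ℕ → ℕ → StairSymb} (hS : IsStaircase n S)
    {c : ℕ → StairSymb} (hc : c ∈ fullCols (freeRows S) n) {x : StairSymb}
    (hx : x ≠ StairSymb.empty) :
    Set.ncard {p : ℕ × ℕ | consCol c S p.1 p.2 = x} =
      Set.ncard {i | c i = x} + Set.ncard {p : ℕ × ℕ | S p.1 p.2 = x} := by
  have hc' := ((mem_fullCols hS.succ_mem_freeRows).1 hc).1
  have hu : {p : ℕ × ℕ | consCol c S p.1 p.2 = x} =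
      (fun i => (i, 1)) '' {i | c i = x} ∪
        (fun p : ℕ × ℕ => (p.1, p.2 + 1)) '' {p : ℕ × ℕ | S p.1 p.2 = x} := by
    ext ⟨i, j⟩
    simp only [Set.mem_ofPred_eq, Set.mem_union, Set.mem_image, Prod.mk.injEq, Prod.exists]
    match j with
    | 0 => simp [consCol, hx.symm]
    | 1 =>
      simp only [consCol]
      constructor
      · intro h
        exact Or.inl ⟨i, h, rfl, trivial⟩
      · rintro (⟨_, h, rfl, -⟩ | ⟨a, b, h, rfl, hb⟩)
        · exact h
        · obtain rfl : b = 0 := by omega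
          exact absurd (h.symm.trans (hS.apply_zero a)) hx
    | j + 2 =>
      simp only [consCol]
      constructor
      · intro h
        exact Or.inr ⟨i, j + 1, h, rfl, rfl⟩
      · rintro (⟨_, -, -, h⟩ | ⟨a, b, h, rfl, hb⟩)
        · omega
        · obtain rfl : b = j + 1 := by omega
          exact h
  have hfc : {i | c i = x}.Finite := by
    refine (Set.finite_Iic (n + 1)).subset fun i hi => ?_
    simp only [Set.mem_ofPred_eq] at hi
    exact ((mem_partialCols.1 hc').1 i (by rw [hi]; exact hx)).2.1
  have hfS : {p : ℕ × ℕ | S p.1 p.2 = x}.Finite :=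
    hS.finite_ne_empty.subset fun p hp => by
      simp only [Set.mem_ofPred_eq] at hp ⊢
      rw [hp]; exact hx
  rw [hu, Set.ncard_union_eq _ (hfc.image _) (hfS.image _), Set.ncard_image_of_injective,
    Set.ncard_image_of_injective]
  · rintro ⟨a, b⟩ ⟨a', b'⟩ h
    simpa using h
  · intro a b h
    simpa using h
  · rw [Set.disjoint_left]
    rintro _ ⟨i, -, rfl⟩ ⟨⟨a, b⟩, h, hab⟩
    simp only [Prod.mk.injEq] at hab
    obtain ⟨rfl, hb⟩ := hab
    obtain rfl : b = 0 := by omega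
    exact hx (Eq.trans (Eq.symm h) (hS.apply_zero a))

lemma stairWt_consCol (α β X : ℝ) {n : ℕ} {S : ℕ → ℕ → StairSymb} (hS : IsStaircase n S)
    {c : ℕ → StairSymb} (hc : c ∈ fullCols (freeRows S) n) :
    stairWt α β (consCol c S) * X ^ freeCount (freeRows (consCol c S)) (n + 1) =
      stairWt α β S * colWt α β X (freeRows S) (n + 1) c := by
  have hF : freeRows (consCol c S) = {i | i ∈ freeRows S ∧ c i ≠ StairSymb.beta} := by
    ext i
    simp only [freeRows, Set.mem_ofPred_eq]
    constructor
    · intro h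
      refine ⟨fun j => ?_, h 1⟩
      match j with
      | 0 => simp [hS.apply_zero]
      | j + 1 => exact h (j + 2)
    · rintro ⟨h, h'⟩ j
      match j with
      | 0 => simp [consCol]
      | 1 => exact h'
      | j + 2 => exact h (j + 1)
  rw [hF, stairWt, ncard_consCol hS hc (by simp), ncard_consCol hS hc (by simp), stairWt, colWt]
  ring

/-- `∏_{i < k} (α (X + i β) + β)`. -/
noncomputable def stairProd (α β : ℝ) (k : ℕ) (X : ℝ) : ℝ :=
  ∏ i ∈ Finset.range k, (α * (X + i * β) + β)

lemma stairProd_succ (α β : ℝ) (k : ℕ) (X : ℝ) :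
    stairProd α β (k + 1) X = (α * X + β) * stairProd α β k (X + β) := by
  rw [stairProd, Finset.prod_range_succ', mul_comm, stairProd]
  congr 1
  · simp
  · refine Finset.prod_congr rfl fun i _ => ?_
    push_cast
    ring

lemma stairProd_pos {α β X : ℝ} (hα : 0 < α) (hβ : 0 < β) (hX : 0 < X) (k : ℕ) :
    0 < stairProd α β k X :=
  Finset.prod_pos fun i _ => by positivity

lemma sum_staircases (α β : ℝ) (n : ℕ) (X : ℝ) :
    ∑ S ∈ staircases n, stairWt α β S * X ^ freeCount (freeRows S) n = stairProd α β n X := by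
  induction n generalizing X with
  | zero => simp [staircases, stairWt, freeCount, stairProd]
  | succ n ih =>
    rw [sum_staircases_succ, stairProd_succ, ← ih, Finset.mul_sum]
    refine Finset.sum_congr rfl fun S hS => ?_
    have hS' := mem_staircases.1 hS
    rw [Finset.sum_congr rfl fun c hc => stairWt_consCol α β X hS' hc, ← Finset.mul_sum,
      sum_colWt_fullCols α β X hS'.succ_mem_freeRows]
    ring

lemma stairZ_eq (n : ℕ) (α β : ℝ) : stairZ n α β = stairProd α β n 1 := by
  have : {S | IsStaircase n S} = (staircases n : Set (ℕ → ℕ → StairSymb)) := by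
    ext S
    simp [mem_staircases]
  rw [stairZ, this, finsum_mem_coe_finset, ← sum_staircases]
  simp

/-- For every `m ∈ M`, the third box from the bottom of the column of height `m` is nonempty, and
the diagonal box in its row is an `α`. -/
def ThirdNonempty (M : Set ℕ) (n : ℕ) (S : ℕ → ℕ → StairSymb) : Prop :=
  ∀ m ∈ M, (m ≤ n → S (m - 2) (n + 1 - m) ≠ StairSymb.empty) ∧
    (m ≤ n + 2 → S (m - 2) (n + 3 - m) = StairSymb.alpha)

lemma ThirdNonempty.of_consCol {M : Set ℕ} {n : ℕ} {S : ℕ → ℕ → StairSymb} {c : ℕ → StairSymb}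
    (h : ThirdNonempty M (n + 1) (consCol c S)) :
    ThirdNonempty M n S ∧ (n + 1 ∈ M → c (n - 1) ≠ StairSymb.empty) ∧
      (n + 3 ∈ M → c (n + 1) = StairSymb.alpha) := by
  refine ⟨fun m hm => ⟨fun hmn => ?_, fun hmn => ?_⟩, fun hm => ?_, fun hm => ?_⟩
  · obtain ⟨k, rfl⟩ := Nat.exists_eq_add_of_le hmn
    have := (h m hm).1 (by omega)
    rw [show m + k + 1 + 1 - m = k + 2 by omega] at this
    rwa [show m + k + 1 - m = k + 1 by omega]
  · obtain ⟨k, hk⟩ := Nat.exists_eq_add_of_le hmn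
    have := (h m hm).2 (by omega)
    rw [show n + 1 + 3 - m = k + 2 by omega] at this
    rwa [show n + 3 - m = k + 1 by omega]
  · have := (h _ hm).1 le_rfl
    rwa [show n + 1 + 1 - (n + 1) = 1 by omega] at this
  · have := (h _ hm).2 (by omega)
    rwa [show n + 1 + 3 - (n + 3) = 1 by omega] at this

open Classical in
/-- The upper bound for the weight of the event `ThirdNonempty M n`. -/
noncomputable def thirdBound (α β : ℝ) (M : Set ℕ) (n : ℕ) (X : ℝ) : ℝ :=
  (2 * α * β) ^ Nat.count (· ∈ M) (n + 1) * (if n + 1 ∈ M then α * (X + β) else 1) *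
    (if n + 2 ∈ M then α * X else 1) * stairProd α β (n - Nat.count (· ∈ M) (n + 3)) X

open Classical in
lemma thirdBound_nonneg {α β X : ℝ} (hα : 0 < α) (hβ : 0 < β) (hX : 0 < X) (M : Set ℕ) (n : ℕ) :
    0 ≤ thirdBound α β M n X := by
  have := stairProd_pos hα hβ hX (n - Nat.count (· ∈ M) (n + 3))
  unfold thirdBound
  positivity

open Classical in
lemma count_add_three_le {M : Set ℕ} (hM : ∀ m ∈ M, 3 ≤ m) (n : ℕ) :
    Nat.count (· ∈ M) (n + 3) ≤ n := by
  induction n with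
  | zero =>
    rw [Nat.count_eq_card_filter_range, Finset.filter_false_of_mem]
    · simp
    · intro m hm hmM
      have := hM m hmM
      simp at hm
      omega
  | succ n ih =>
    rw [show n + 1 + 3 = n + 3 + 1 by ring, Nat.count_succ]
    split_ifs <;> omega

open Classical in
lemma sum_thirdNonempty_le {α β X : ℝ} (hα : 0 < α) (hβ : 0 < β) (hX : 0 < X) {M : Set ℕ}
    (hM : ∀ m ∈ M, 3 ≤ m) (n : ℕ) :
    ∑ S ∈ staircases n with ThirdNonempty M n S,
      stairWt α β S * X ^ freeCount (freeRows S) n ≤ thirdBound α β M n X := by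
  have hwt : ∀ S, 0 ≤ stairWt α β S := fun S => by unfold stairWt; positivity
  induction n generalizing X with
  | zero =>
    have h1 : 0 + 1 ∉ M := fun h => absurd (hM _ h) (by omega)
    have h2 : 0 + 2 ∉ M := fun h => absurd (hM _ h) (by omega)
    have hc := Nat.le_zero.1 (count_add_three_le hM 0)
    have hc' : Nat.count (· ∈ M) (0 + 1) = 0 :=
      Nat.le_zero.1 ((Nat.count_monotone _ (show 0 + 1 ≤ 0 + 3 by omega)).trans hc.le)
    rw [thirdBound, if_neg h1, if_neg h2, hc, hc']
    refine (Finset.sum_le_sum_of_subset_of_nonneg (Finset.filter_subset _ _)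
      fun S _ _ => mul_nonneg (hwt S) (by positivity)).trans ?_
    rw [sum_staircases]
    simp
  | succ n ih =>
    have key : ∀ {K Y : ℝ}, 0 < Y →
        (∀ S ∈ staircases n, ∑ c ∈ fullCols (freeRows S) n with
          ((n + 1 ∈ M → c (n - 1) ≠ StairSymb.empty) ∧ (n + 3 ∈ M → c (n + 1) = StairSymb.alpha)),
          colWt α β X (freeRows S) (n + 1) c ≤ K * Y ^ freeCount (freeRows S) n) → 0 ≤ K →
        ∑ S ∈ staircases (n + 1) with ThirdNonempty M (n + 1) S,
          stairWt α β S * X ^ freeCount (freeRows S) (n + 1) ≤ K * thirdBound α β M n Y := by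
      intro K Y hY hK hK0
      refine le_trans ?_ (mul_le_mul_of_nonneg_left (ih hY) hK0)
      rw [Finset.sum_filter, sum_staircases_succ, Finset.sum_filter, Finset.mul_sum]
      refine Finset.sum_le_sum fun S hS => ?_
      have hS' := mem_staircases.1 hS
      by_cases hE : ThirdNonempty M n S
      · rw [if_pos hE, mul_left_comm]
        refine le_trans ?_ (mul_le_mul_of_nonneg_left (hK S hS) (hwt S))
        rw [Finset.sum_filter, Finset.mul_sum]
        refine Finset.sum_le_sum fun c hc => ?_
        rw [stairWt_consCol α β X hS' hc]
        split_ifs with h1 h2 h2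
        · exact le_rfl
        · exact absurd h1.of_consCol.2 h2
        · exact mul_nonneg (hwt S) (colWt_nonneg hα hβ hX _ _ _)
        · simp
      · rw [if_neg hE, mul_zero]
        refine (Finset.sum_eq_zero fun c _ => ?_).le
        rw [if_neg fun h => hE h.of_consCol.1]
    have hcount := count_add_three_le hM n
    have hc1 := Nat.count_succ (· ∈ M) (n + 1)
    have hc3 := Nat.count_succ (· ∈ M) (n + 3)
    have hprod := stairProd_pos hα hβ (add_pos hX hβ) (n - Nat.count (· ∈ M) (n + 3))
    by_cases h3 : n + 3 ∈ M
    · by_cases h1 : n + 1 ∈ M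
      · -- the bottom box would be an `α` below a nonempty box
        have := key (K := 0) (Y := X) hX (fun S hS => ?_) le_rfl
        · rw [zero_mul] at this
          exact this.trans (thirdBound_nonneg hα hβ hX M _)
        · have hn := hM _ h1
          rw [zero_mul]
          refine (Finset.sum_eq_zero fun c hc => ?_).le
          obtain ⟨hc, hc'⟩ := Finset.mem_filter.1 hc
          have hcol := ((mem_fullCols (mem_staircases.1 hS).succ_mem_freeRows).1 hc).1
          exact absurd ((mem_partialCols.1 hcol).2 (n - 1) (n + 1) (by omega) (hc'.2 h3))
            (hc'.1 h1)
      · refine (key (K := α * X) (Y := X) hX (fun S hS => ?_) (by positivity)).trans ?_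
        · rw [← sum_colWt_fullCols_alpha α β X (mem_staircases.1 hS).succ_mem_freeRows]
          refine le_of_eq (Finset.sum_congr (Finset.filter_congr fun c _ => ?_) fun _ _ => rfl)
          simp [h1, h3]
        · rw [thirdBound, thirdBound, hc1, hc3, if_neg h1, if_neg h1, if_pos h3, if_pos h3,
            Nat.add_sub_add_right]
          have hle : (if n + 2 ∈ M then α * X else 1) ≤ if n + 2 ∈ M then α * (X + β) else 1 := by
            split_ifs
            · exact mul_le_mul_of_nonneg_left (by linarith) hα.le
            · exact le_rfl
          have hQ := stairProd_pos hα hβ hX (n - Nat.count (· ∈ M) (n + 3))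
          set R := (2 * α * β) ^ Nat.count (· ∈ M) (n + 1) * (α * X) *
            stairProd α β (n - Nat.count (· ∈ M) (n + 3)) X with hR
          have hR0 : 0 ≤ R := by positivity
          calc _ = R * (if n + 2 ∈ M then α * X else 1) := by rw [hR]; ring
            _ ≤ R * (if n + 2 ∈ M then α * (X + β) else 1) := mul_le_mul_of_nonneg_left hle hR0
            _ = _ := by rw [hR, add_zero]; ring
    · have hlen : n + 1 - Nat.count (· ∈ M) (n + 3) = n - Nat.count (· ∈ M) (n + 3) + 1 := by
        omega
      by_cases h1 : n + 1 ∈ M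
      · refine (key (K := β / (X + β) * (α * X + β)) (Y := X + β) (by positivity) (fun S hS => ?_)
          (by positivity)).trans ?_
        · obtain ⟨m, rfl⟩ : ∃ m, n = m + 2 := ⟨n - 2, by have := hM _ h1; omega⟩
          refine le_trans (le_of_eq (Finset.sum_congr (Finset.filter_congr fun c _ => ?_)
            fun _ _ => rfl)) (sum_colWt_fullCols_third_le hα hβ hX (freeRows S) m)
          simp [h1, h3]
        · rw [thirdBound, thirdBound, hc1, hc3, if_pos h1, if_pos h1, if_neg h3, if_neg h3,
            add_zero, hlen, stairProd_succ]
          have hXβ : 0 < X + β := by positivity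
          have h2 : β / (X + β) * (α * (X + β + β)) ≤ 2 * α * β := by
            rw [div_mul_eq_mul_div, div_le_iff₀ hXβ]
            nlinarith [mul_pos (mul_pos hα hβ) hX]
          set R := (2 * α * β) ^ Nat.count (· ∈ M) (n + 1) *
            (if n + 2 ∈ M then α * (X + β) else 1) *
            ((α * X + β) * stairProd α β (n - Nat.count (· ∈ M) (n + 3)) (X + β)) with hR
          have hR0 : 0 ≤ R := by positivity
          calc _ = β / (X + β) * (α * (X + β + β)) * R := by rw [hR]; ring
            _ ≤ 2 * α * β * R := mul_le_mul_of_nonneg_right h2 hR0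
            _ = _ := by rw [hR]; ring
      · refine (key (K := α * X + β) (Y := X + β) (by positivity) (fun S hS => ?_)
          (by positivity)).trans (le_of_eq ?_)
        · rw [← sum_colWt_fullCols α β X (mem_staircases.1 hS).succ_mem_freeRows]
          exact Finset.sum_le_sum_of_subset_of_nonneg (Finset.filter_subset _ _)
            fun c _ _ => colWt_nonneg hα hβ hX _ _ _
        · rw [thirdBound, thirdBound, hc1, hc3, if_neg h1, if_neg h1, if_neg h3, if_neg h3,
            add_zero, add_zero, hlen, stairProd_succ]
          ring

lemma thirdBound_coe (α β X : ℝ) {M : Finset ℕ} {n : ℕ} (hM : ∀ m ∈ M, m ≤ n) :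
    thirdBound α β M n X = (2 * α * β) ^ M.card * stairProd α β (n - M.card) X := by
  classical
  have h1 : n + 1 ∉ M := fun h => absurd (hM _ h) (by omega)
  have h2 : n + 2 ∉ M := fun h => absurd (hM _ h) (by omega)
  have hcount : ∀ k, n + 1 ≤ k → (Finset.range k).filter (· ∈ (M : Set ℕ)) = M := by
    intro k hk
    ext m
    simp only [Finset.mem_filter, Finset.mem_range, Finset.mem_coe]
    refine ⟨fun h => h.2, fun h => ⟨?_, h⟩⟩
    have := hM m h
    omega
  rw [thirdBound, Nat.count_eq_card_filter_range, Nat.count_eq_card_filter_range]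
  simp only [Finset.mem_coe, h1, h2, if_false, mul_one]
  congr! 3
  · simpa using hcount (n + 1) le_rfl
  · congr 1
    simpa using hcount (n + 3) (by omega)

lemma stairProd_sub_div_le {α β : ℝ} (hα : 0 < α) (hβ : 0 < β) {n r : ℕ} (hr : r < n) :
    (2 * α * β) ^ r * stairProd α β (n - r) 1 / stairProd α β n 1 ≤
      (2 * (r + 1)) ^ r / ((n : ℝ) + 1 / α + 1 / β) ^ r := by
  obtain ⟨k, rfl⟩ : ∃ k, n = k + 1 + r := ⟨n - r - 1, by omega⟩
  have hsplit : stairProd α β (k + 1 + r) 1 = stairProd α β (k + 1) 1 *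
      ∏ i ∈ Finset.range r, (α * (1 + ((k + 1 + i : ℕ) : ℝ) * β) + β) :=
    Finset.prod_range_add _ _ _
  have hpos := stairProd_pos hα hβ one_pos (k + 1)
  set N : ℝ := ((k + 1 + r : ℕ) : ℝ) + 1 / α + 1 / β with hN
  have hNpos : 0 < N := by positivity
  have hfac : (α * β * N / (r + 1)) ^ r ≤
      ∏ i ∈ Finset.range r, (α * (1 + ((k + 1 + i : ℕ) : ℝ) * β) + β) := by
    refine le_trans (le_of_eq (by rw [Finset.prod_const, Finset.card_range]))
      (Finset.prod_le_prod (f := fun _ => α * β * N / (r + 1)) (fun i _ => by positivity)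
        fun i _ => ?_)
    have hab : α * β * N = α * β * (k + 1 + r) + β + α := by
      rw [hN]
      push_cast
      field_simp
    rw [div_le_iff₀ (by positivity), hab]
    push_cast
    have h1 : 0 ≤ α * β * (k * r) := by positivity
    have h2 : 0 ≤ α * β * (i * (r + 1)) := by positivity
    have h3 : 0 ≤ (α + β) * r := by positivity
    nlinarith
  rw [Nat.add_sub_cancel, hsplit, mul_comm (stairProd _ _ _ _), mul_div_mul_right _ _ hpos.ne']
  refine (div_le_div_of_nonneg_left (by positivity) (by positivity) hfac).trans (le_of_eq ?_)
  rw [← div_pow, ← div_pow]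
  congr 1
  field_simp

/-- If some two consecutive chosen columns on the third main diagonal are at distance
at most `2`, the probability that all chosen boxes are nonempty is `O(1/(n+a+b)^r)`
uniformly. -/
theorem nonempty_on_third_diagonal_close_columns (r : ℕ) (hr : 2 ≤ r) :
    ∃ C : ℝ, 0 < C ∧ ∀ n : ℕ, 3 ≤ n → ∀ α β : ℝ, 0 < α → 0 < β →
      ∀ j : Fin r → ℕ, (∀ l, 1 ≤ j l) → (∀ l, j l ≤ n - 2) → StrictMono j →
      (∃ l : Fin r, ∃ h : (l : ℕ) + 1 < r, j ⟨(l : ℕ) + 1, h⟩ ≤ j l + 2) →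
      stairP n α β (fun S => ∀ l : Fin r, S (n - j l - 1) (j l) ≠ StairSymb.empty)
        ≤ C / ((n : ℝ) + 1/α + 1/β) ^ r := by
  classical
  refine ⟨(2 * (r + 1)) ^ r, by positivity, ?_⟩
  intro n hn α β hα hβ j hj1 hj2 hj _
  have hrn : r ≤ n - 2 := by
    have := Finset.card_le_card_of_injOn (s := (Finset.univ : Finset (Fin r)))
      (t := Finset.Icc 1 (n - 2)) j (fun l _ => by simp [hj1 l, hj2 l]) hj.injective.injOn
    simpa using this
  set M : Finset ℕ := Finset.univ.image fun l => n + 1 - j l with hMdef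
  have hM3 : ∀ m ∈ M, 3 ≤ m := by
    intro m hm
    obtain ⟨l, -, rfl⟩ := Finset.mem_image.1 hm
    have := hj2 l
    omega
  have hMn : ∀ m ∈ M, m ≤ n := by
    intro m hm
    obtain ⟨l, -, rfl⟩ := Finset.mem_image.1 hm
    have := hj1 l
    omega
  have hcard : M.card = r := by
    rw [hMdef, Finset.card_image_of_injective, Finset.card_univ, Fintype.card_fin]
    intro l l' h
    refine hj.injective ?_
    have := hj2 l
    have := hj2 l'
    dsimp only at h
    omega
  have hbound := sum_thirdNonempty_le hα hβ one_pos (M := M) hM3 n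
  rw [thirdBound_coe α β 1 hMn, hcard] at hbound
  simp only [one_pow, mul_one] at hbound
  have hset : {S | IsStaircase n S ∧ ∀ l : Fin r, S (n - j l - 1) (j l) ≠ StairSymb.empty} =
      ((staircases n).filter fun S => ∀ l : Fin r, S (n - j l - 1) (j l) ≠ StairSymb.empty :
        Finset (ℕ → ℕ → StairSymb)) := by
    ext S
    simp [mem_staircases]
  rw [stairP, hset, finsum_mem_coe_finset, stairZ_eq]
  refine le_trans ?_ (stairProd_sub_div_le hα hβ (show r < n by omega))
  refine div_le_div_of_nonneg_right (le_trans ?_ hbound) (stairProd_pos hα hβ one_pos n).le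
  refine Finset.sum_le_sum_of_subset_of_nonneg (fun S hS => ?_)
    fun S _ _ => by unfold stairWt; positivity
  obtain ⟨hS, hE⟩ := Finset.mem_filter.1 hS
  refine Finset.mem_filter.2 ⟨hS, ?_⟩
  obtain ⟨_, _, hβrow, hdiag⟩ := mem_staircases.1 hS
  intro m hm
  obtain ⟨l, -, rfl⟩ := Finset.mem_image.1 hm
  have hl1 := hj1 l
  have hl2 := hj2 l
  have hl := hE l
  rw [show n + 1 - j l - 2 = n - j l - 1 by omega, show n + 1 - (n + 1 - j l) = j l by omega,
    show n + 3 - (n + 1 - j l) = j l + 2 by omega]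
  refine ⟨fun _ => hl, fun _ => ?_⟩
  cases hx : S (n - j l - 1) (j l + 2) with
  | alpha => rfl
  | empty => exact absurd hx (hdiag _ _ (by omega) (by omega) (by omega))
  | beta => exact absurd (hβrow _ (j l) _ (by omega) hl1 (by omega) (by omega) hx) hl
end

section
/- Fix α, β ∈ (0, ∞). Let X_n^{(3)} be the number of nonempty boxes on the third main diagonal of a random α/β-staircase tableau of size n. Then X_n^{(3)} converges in distribution to a Poisson random variable with parameter 1: for every integer k ≥ 0, ℙ_{n,α,β}(X_n^{(3)} = k) → e^{−1} / k! as n → ∞. -/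
open scoped BigOperators

namespace Staircase

open Finset Function

open scoped Classical

/-- The weight of a single symbol. -/
def symbWt (α β : ℝ) : StairSymb → ℝ
  | .empty => 1
  | .alpha => α
  | .beta => β

/-- The column whose only symbol is an `α` in row `m`. -/
def alphaCol (m : ℕ) : ℕ → StairSymb := update (fun _ => .empty) m .alpha

/-- The fillings of rows `1, …, m` of a column in which only the rows of `R` may be nonempty and
every box above an `α` is empty. -/
noncomputable def openCols (R : Set ℕ) : ℕ → Finset (ℕ → StairSymb)
  | 0 => {fun _ => .empty}
  | m + 1 => openCols R m ∪
      if m + 1 ∈ R then (openCols R m).image (fun C => update C (m + 1) .beta) ∪ {alphaCol (m + 1)}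
      else ∅

lemma openCols_eq_empty {R : Set ℕ} {m : ℕ} {C : ℕ → StairSymb} (hC : C ∈ openCols R m)
    {i : ℕ} (hi : m < i) : C i = .empty := by
  induction m generalizing C with
  | zero => simp only [openCols, mem_singleton] at hC; subst hC; rfl
  | succ m ih =>
    have hne : i ≠ m + 1 := by omega
    rw [openCols, mem_union] at hC
    rcases hC with hC | hC
    · exact ih hC (by omega)
    · split_ifs at hC
      · simp only [mem_union, mem_image, mem_singleton] at hC
        rcases hC with ⟨C', hC', rfl⟩ | rfl
        · simpa [hne] using ih hC' (by omega)
        · simp [alphaCol, hne]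
      · simp at hC

lemma mem_openCols {R : Set ℕ} {m : ℕ} {C : ℕ → StairSymb} :
    C ∈ openCols R m ↔ (∀ i, C i ≠ .empty → 1 ≤ i ∧ i ≤ m ∧ i ∈ R) ∧
      ∀ i i', i < i' → C i' = .alpha → C i = .empty := by
  induction m generalizing C with
  | zero =>
    simp only [openCols, mem_singleton]
    constructor
    · rintro rfl; simp
    · rintro ⟨h, -⟩
      funext i
      by_contra hi
      have := h i hi
      omega
  | succ m ih =>
    constructor
    · intro hC
      rw [openCols, mem_union] at hC
      rcases hC with hC | hC
      · obtain ⟨h1, h2⟩ := ih.1 hC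
        refine ⟨fun i hi => ?_, h2⟩
        obtain ⟨ha, hb, hc⟩ := h1 i hi
        exact ⟨ha, by omega, hc⟩
      · split_ifs at hC with hR
        · simp only [mem_union, mem_image, mem_singleton] at hC
          rcases hC with ⟨C', hC', rfl⟩ | rfl
          · obtain ⟨h1, h2⟩ := ih.1 hC'
            refine ⟨fun i hi => ?_, fun i i' hii' hi' => ?_⟩
            · by_cases him : i = m + 1
              · subst him; exact ⟨by omega, le_rfl, hR⟩
              · rw [update_of_ne him] at hi
                obtain ⟨ha, hb, hc⟩ := h1 i hi
                exact ⟨ha, by omega, hc⟩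
            · have him' : i' ≠ m + 1 := by rintro rfl; simp at hi'
              rw [update_of_ne him'] at hi'
              have := h1 i' (by simp [hi'])
              rw [update_of_ne (by omega)]
              exact h2 i i' hii' hi'
          · refine ⟨fun i hi => ?_, fun i i' hii' hi' => ?_⟩
            · by_cases him : i = m + 1
              · subst him; exact ⟨by omega, le_rfl, hR⟩
              · simp [alphaCol, him] at hi
            · by_cases him : i' = m + 1
              · subst him; simp [alphaCol, hii'.ne]
              · simp [alphaCol, him] at hi'
        · simp at hC
    · rintro ⟨h1, h2⟩
      rw [openCols, mem_union]
      cases hm : C (m + 1) with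
      | empty =>
        left
        refine ih.2 ⟨fun i hi => ?_, h2⟩
        obtain ⟨ha, hb, hc⟩ := h1 i hi
        have : i ≠ m + 1 := by rintro rfl; exact hi hm
        exact ⟨ha, by omega, hc⟩
      | alpha =>
        right
        have hR := (h1 (m + 1) (by simp [hm])).2.2
        rw [if_pos hR, mem_union]
        right
        rw [mem_singleton]
        funext i
        by_cases him : i = m + 1
        · subst him; simp [alphaCol, hm]
        · simp only [alphaCol, update_of_ne him]
          by_contra hi
          have := h1 i hi
          exact hi (h2 i (m + 1) (by omega) hm)
      | beta =>
        right
        have hR := (h1 (m + 1) (by simp [hm])).2.2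
        rw [if_pos hR, mem_union, mem_image]
        left
        refine ⟨update C (m + 1) .empty, ih.2 ⟨fun i hi => ?_, fun i i' hii' hi' => ?_⟩, ?_⟩
        · by_cases him : i = m + 1
          · subst him; simp at hi
          · rw [update_of_ne him] at hi
            obtain ⟨ha, hb, hc⟩ := h1 i hi
            exact ⟨ha, by omega, hc⟩
        · by_cases him : i = m + 1
          · subst him; simp
          · rw [update_of_ne him]
            refine h2 i i' hii' ?_
            by_cases him' : i' = m + 1
            · subst him'; simp at hi'
            · rwa [update_of_ne him'] at hi'
        · simp [← hm]

/-- The weight of rows `1, …, m` of a column. -/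
def colWt (α β : ℝ) (m : ℕ) (C : ℕ → StairSymb) : ℝ := ∏ i ∈ Icc 1 m, symbWt α β (C i)

/-- The weighted sum of `Φ` over `openCols R m`. -/
noncomputable def openSum (α β : ℝ) (R : Set ℕ) (m : ℕ) (Φ : (ℕ → StairSymb) → ℝ) : ℝ :=
  ∑ C ∈ openCols R m, colWt α β m C * Φ C

lemma colWt_succ (α β : ℝ) (m : ℕ) (C : ℕ → StairSymb) :
    colWt α β (m + 1) C = colWt α β m C * symbWt α β (C (m + 1)) := by
  rw [colWt, prod_Icc_succ_top (by omega)]; rfl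

lemma colWt_update (α β : ℝ) (m : ℕ) (C : ℕ → StairSymb) (s : StairSymb) :
    colWt α β m (update C (m + 1) s) = colWt α β m C := by
  refine prod_congr rfl fun i hi => ?_
  rw [mem_Icc] at hi
  rw [update_of_ne (by omega)]

lemma colWt_alphaCol (α β : ℝ) (m : ℕ) : colWt α β (m + 1) (alphaCol (m + 1)) = α := by
  rw [colWt_succ, alphaCol, colWt_update]
  simp [colWt, symbWt]

lemma injOn_update_openCols (R : Set ℕ) (m : ℕ) (s : StairSymb) :
    Set.InjOn (fun C : ℕ → StairSymb => update C (m + 1) s) (openCols R m) := by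
  intro C hC C' hC' h
  funext i
  by_cases him : i = m + 1
  · rw [openCols_eq_empty hC (by omega), openCols_eq_empty hC' (by omega)]
  · simpa [him] using congrFun h i

lemma openSum_succ (α β : ℝ) (R : Set ℕ) (m : ℕ) (Φ : (ℕ → StairSymb) → ℝ) :
    openSum α β R (m + 1) Φ = openSum α β R m Φ +
      if m + 1 ∈ R then β * openSum α β R m (fun C => Φ (update C (m + 1) .beta)) +
        α * Φ (alphaCol (m + 1)) else 0 := by
  have h0 : ∑ C ∈ openCols R m, colWt α β (m + 1) C * Φ C = openSum α β R m Φ := by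
    refine sum_congr rfl fun C hC => ?_
    rw [colWt_succ, openCols_eq_empty hC (by omega)]
    simp [symbWt]
  rw [openSum, openCols]
  split_ifs with hR
  · rw [sum_union, sum_union, h0, sum_image (injOn_update_openCols R m _), sum_singleton,
      colWt_alphaCol, openSum, openSum, mul_sum]
    · congr 2
      refine sum_congr rfl fun C _ => ?_
      rw [colWt_succ, colWt_update]
      simp [symbWt]; ring
    · rw [disjoint_singleton_right, mem_image]
      rintro ⟨C, -, h⟩
      simpa [alphaCol] using congrFun h (m + 1)
    · rw [disjoint_left]
      intro C hC hC'
      have h1 := openCols_eq_empty hC (i := m + 1) (by omega)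
      simp only [mem_union, mem_image, mem_singleton] at hC'
      rcases hC' with ⟨C', -, rfl⟩ | rfl
      · simp at h1
      · simp [alphaCol] at h1
  · simpa using h0

lemma openSum_congr {α β : ℝ} {R : Set ℕ} {m : ℕ} {Φ Ψ : (ℕ → StairSymb) → ℝ}
    (h : ∀ C ∈ openCols R m, Φ C = Ψ C) : openSum α β R m Φ = openSum α β R m Ψ :=
  sum_congr rfl fun C hC => by rw [h C hC]

lemma openSum_mul_left (α β : ℝ) (R : Set ℕ) (m : ℕ) (c : ℝ) (Φ : (ℕ → StairSymb) → ℝ) :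
    openSum α β R m (fun C => c * Φ C) = c * openSum α β R m Φ := by
  simp only [openSum, mul_sum]
  exact sum_congr rfl fun C _ => by ring

/-- The admissible columns with `m` boxes whose bottom box is nonempty. -/
noncomputable def cols (R : Set ℕ) (m : ℕ) : Finset (ℕ → StairSymb) :=
  (openCols R m).filter fun C => C m ≠ .empty

/-- The weighted sum of `Φ` over the admissible columns with `m + 1` boxes. -/
noncomputable def colSum (α β : ℝ) (R : Set ℕ) (m : ℕ) (Φ : (ℕ → StairSymb) → ℝ) : ℝ :=
  ∑ C ∈ cols R (m + 1), colWt α β (m + 1) C * Φ C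

lemma colSum_eq {α β : ℝ} {R : Set ℕ} {m : ℕ} (hR : m + 1 ∈ R) (Φ : (ℕ → StairSymb) → ℝ) :
    colSum α β R m Φ = α * Φ (alphaCol (m + 1)) +
      β * openSum α β R m (fun C => Φ (update C (m + 1) .beta)) := by
  have h : colSum α β R m Φ =
      openSum α β R (m + 1) (fun C => if C (m + 1) ≠ .empty then Φ C else 0) := by
    rw [colSum, cols, sum_filter, openSum]
    exact sum_congr rfl fun C _ => by split_ifs <;> simp
  rw [h, openSum_succ, if_pos hR]
  have h0 : openSum α β R m (fun C => if C (m + 1) ≠ .empty then Φ C else 0) = 0 := by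
    refine sum_eq_zero fun C hC => ?_
    simp [openCols_eq_empty hC (Nat.lt_succ_self m)]
  rw [h0]
  simp [alphaCol]
  ring

lemma colSum_mul_right (α β : ℝ) (R : Set ℕ) (m : ℕ) (c : ℝ) (Φ : (ℕ → StairSymb) → ℝ) :
    colSum α β R m (fun C => Φ C * c) = colSum α β R m Φ * c := by
  simp only [colSum, sum_mul, mul_assoc]

/-- The rows of `R` left free of `β` by the column `C`. -/
def remaining (R : Set ℕ) (C : ℕ → StairSymb) : Set ℕ := {i | i ∈ R ∧ C i ≠ .beta}

/-- The number of elements of `R` among `1, …, m`. -/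
noncomputable def count (m : ℕ) (R : Set ℕ) : ℕ := ((Icc 1 m).filter (· ∈ R)).card

lemma count_succ (m : ℕ) (R : Set ℕ) :
    count (m + 1) R = count m R + if m + 1 ∈ R then 1 else 0 := by
  rw [count, ← insert_Icc_right_eq_Icc_add_one (by omega), filter_insert]
  split_ifs
  · rw [card_insert_of_notMem (by simp)]; rfl
  · rfl

lemma count_congr {m : ℕ} {R R' : Set ℕ} (h : ∀ i, 1 ≤ i → i ≤ m → (i ∈ R ↔ i ∈ R')) :
    count m R = count m R' := by
  unfold count
  congr 1
  refine filter_congr fun i hi => ?_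
  rw [mem_Icc] at hi
  exact h i hi.1 hi.2

lemma count_remaining_update {m k : ℕ} (hk : m < k) (R : Set ℕ) (C : ℕ → StairSymb)
    (s : StairSymb) : count m (remaining R (update C k s)) = count m (remaining R C) :=
  count_congr fun i _ hi => by simp [remaining, update_of_ne (show i ≠ k by omega)]

lemma remaining_alphaCol (R : Set ℕ) (k : ℕ) : remaining R (alphaCol k) = R := by
  ext i
  by_cases h : i = k
  · subst h; simp [remaining, alphaCol]
  · simp [remaining, alphaCol, h]

lemma mem_remaining {R : Set ℕ} {C : ℕ → StairSymb} {i : ℕ} :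
    i ∈ remaining R C ↔ i ∈ R ∧ C i ≠ .beta := Iff.rfl

lemma mul_openSum_pow_count (α β : ℝ) (R : Set ℕ) (m : ℕ) (x : ℝ) :
    β * openSum α β R m (fun C => x ^ count m (remaining R C)) =
      (β + α * x) * (x + β) ^ count m R - α * x * x ^ count m R := by
  induction m with
  | zero => simp [openSum, openCols, colWt, count]
  | succ m ih =>
    have h0 : openSum α β R m (fun C => x ^ count (m + 1) (remaining R C)) =
        (if m + 1 ∈ R then x else 1) * openSum α β R m (fun C => x ^ count m (remaining R C)) := by
      rw [← openSum_mul_left]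
      refine openSum_congr fun C hC => ?_
      rw [count_succ]
      simp only [mem_remaining, openCols_eq_empty hC (Nat.lt_succ_self m)]
      split_ifs <;> simp_all [pow_succ, mul_comm]
    rw [openSum_succ, h0, count_succ m R]
    split_ifs with hR
    · simp only [count_succ, count_remaining_update (Nat.lt_succ_self m), remaining_alphaCol,
        if_pos hR]
      simp only [mem_remaining, update_self, ne_eq, not_true_eq_false, and_false,
        if_false, add_zero]
      rw [pow_succ, pow_succ]
      linear_combination (x + β) * ih
    · simpa using ih

/-- The indicator of the box in row `i` of the column `C` being nonempty. -/
noncomputable def filled (C : ℕ → StairSymb) (i : ℕ) : ℝ := if C i = .empty then 0 else 1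

lemma filled_update_of_ne {C : ℕ → StairSymb} {i k : ℕ} (h : i ≠ k) (s : StairSymb) :
    filled (update C k s) i = filled C i := by simp [filled, h]

lemma filled_alphaCol_of_ne {i k : ℕ} (h : i ≠ k) : filled (alphaCol k) i = 0 := by
  simp [filled, alphaCol, h]

lemma count_remaining_of_mem_openCols {R : Set ℕ} {m : ℕ} {C : ℕ → StairSymb}
    (hC : C ∈ openCols R m) :
    count (m + 1) (remaining R C) = count m (remaining R C) + if m + 1 ∈ R then 1 else 0 := by
  rw [count_succ]
  simp [mem_remaining, openCols_eq_empty hC (Nat.lt_succ_self m)]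

lemma count_remaining_update_beta (R : Set ℕ) (m : ℕ) (C : ℕ → StairSymb) :
    count (m + 1) (remaining R (update C (m + 1) .beta)) = count m (remaining R C) := by
  rw [count_succ, count_remaining_update (Nat.lt_succ_self m)]
  simp [mem_remaining]

lemma colSum_pow_count {α β : ℝ} {R : Set ℕ} {m : ℕ} (hR : m + 1 ∈ R) (x : ℝ) :
    colSum α β R m (fun C => x ^ count (m + 1) (remaining R C)) =
      (β + α * x) * (x + β) ^ count m R := by
  simp only [colSum_eq hR, remaining_alphaCol, count_remaining_update_beta]
  rw [mul_openSum_pow_count, count_succ, if_pos hR, pow_succ]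
  ring

lemma openSum_filled_mul_pow_count (α β : ℝ) (R : Set ℕ) (m : ℕ) (x : ℝ) :
    openSum α β R (m + 1) (fun C => filled C (m + 1) * x ^ count (m + 1) (remaining R C)) =
      if m + 1 ∈ R then (β + α * x) * (x + β) ^ count m R else 0 := by
  have h0 : openSum α β R m
      (fun C => filled C (m + 1) * x ^ count (m + 1) (remaining R C)) = 0 :=
    sum_eq_zero fun C hC => by simp [filled, openCols_eq_empty hC (Nat.lt_succ_self m)]
  rw [openSum_succ, h0]
  split_ifs with hR
  · simp only [count_remaining_update_beta, remaining_alphaCol]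
    simp only [filled, alphaCol, update_self, reduceCtorEq, if_false, one_mul]
    rw [mul_openSum_pow_count, count_succ, if_pos hR, pow_succ]
    ring
  · simp

lemma openSum_filled_mul_pow_count_succ (α β : ℝ) (R : Set ℕ) (m : ℕ) (x : ℝ) :
    openSum α β R (m + 2) (fun C => filled C (m + 1) * x ^ count (m + 2) (remaining R C)) =
      (if m + 2 ∈ R then x + β else 1) *
        if m + 1 ∈ R then (β + α * x) * (x + β) ^ count m R else 0 := by
  have h0 : openSum α β R (m + 1)
      (fun C => filled C (m + 1) * x ^ count (m + 2) (remaining R C)) =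
      (if m + 2 ∈ R then x else 1) *
        if m + 1 ∈ R then (β + α * x) * (x + β) ^ count m R else 0 := by
    rw [← openSum_filled_mul_pow_count, ← openSum_mul_left]
    refine openSum_congr fun C hC => ?_
    rw [count_remaining_of_mem_openCols hC]
    split_ifs <;> simp [pow_succ]; ring
  rw [openSum_succ, h0]
  simp only [count_remaining_update_beta, filled_alphaCol_of_ne (show m + 1 ≠ m + 1 + 1 by omega),
    filled_update_of_ne (show m + 1 ≠ m + 1 + 1 by omega), openSum_filled_mul_pow_count]
  by_cases h : m + 2 ∈ R
  · simp only [h, if_true]; ring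
  · simp only [h, if_false]; ring

/-- Total weight of a column whose third box from below is nonempty. -/
lemma colSum_filled_mul_pow_count {α β : ℝ} {R : Set ℕ} {m : ℕ} (hR : m + 3 ∈ R) (x : ℝ) :
    colSum α β R (m + 2) (fun C => filled C (m + 1) * x ^ count (m + 3) (remaining R C)) =
      β * ((if m + 2 ∈ R then x + β else 1) *
        if m + 1 ∈ R then (β + α * x) * (x + β) ^ count m R else 0) := by
  rw [← openSum_filled_mul_pow_count_succ, colSum_eq hR]
  simp only [count_remaining_update_beta, filled_alphaCol_of_ne (show m + 1 ≠ m + 2 + 1 by omega),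
    filled_update_of_ne (show m + 1 ≠ m + 2 + 1 by omega)]
  ring

lemma colSum_congr {α β : ℝ} {R : Set ℕ} {m : ℕ} {Φ Ψ : (ℕ → StairSymb) → ℝ}
    (h : ∀ C ∈ cols R (m + 1), Φ C = Ψ C) : colSum α β R m Φ = colSum α β R m Ψ :=
  sum_congr rfl fun C hC => by rw [h C hC]

lemma colSum_mul_left (α β : ℝ) (R : Set ℕ) (m : ℕ) (c : ℝ) (Φ : (ℕ → StairSymb) → ℝ) :
    colSum α β R m (fun C => c * Φ C) = c * colSum α β R m Φ := by
  simp only [mul_comm c, colSum_mul_right]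

lemma mem_remaining_of_mem_cols {R : Set ℕ} {m i : ℕ} {C : ℕ → StairSymb} (hC : C ∈ cols R m)
    (hi : m < i) (hR : i ∈ R) : i ∈ remaining R C := by
  rw [mem_remaining, openCols_eq_empty (mem_filter.1 hC).1 hi]
  exact ⟨hR, by simp⟩

lemma notMem_remaining_update_beta (R : Set ℕ) (C : ℕ → StairSymb) (k : ℕ) :
    k ∉ remaining R (update C k .beta) := by simp [mem_remaining]

lemma mem_remaining_update_of_ne {R : Set ℕ} {C : ℕ → StairSymb} {i k : ℕ} (h : i ≠ k)
    (s : StairSymb) : i ∈ remaining R (update C k s) ↔ i ∈ remaining R C := by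
  simp [mem_remaining, h]

lemma openSum_ite_mem_remaining_mul_pow_count (α β : ℝ) (R : Set ℕ) (n : ℕ) (x : ℝ) :
    β * openSum α β R (n + 1) (fun C =>
        if n + 1 ∈ remaining R C then x ^ count n (remaining R C) else 0) =
      if n + 1 ∈ R then (β + α * x) * (x + β) ^ count n R - α * x * x ^ count n R +
        α * β * x ^ count n R else 0 := by
  have h0 : openSum α β R n (fun C =>
        if n + 1 ∈ remaining R C then x ^ count n (remaining R C) else 0) =
      (if n + 1 ∈ R then 1 else 0) * openSum α β R n (fun C => x ^ count n (remaining R C)) := by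
    rw [← openSum_mul_left]
    refine openSum_congr fun C hC => ?_
    simp [mem_remaining, openCols_eq_empty hC (Nat.lt_succ_self n)]
  rw [openSum_succ, h0]
  by_cases hR : n + 1 ∈ R
  · simp only [notMem_remaining_update_beta, remaining_alphaCol, if_false, hR, if_true]
    rw [← mul_openSum_pow_count]
    simp only [openSum, mul_zero, sum_const_zero]
    ring
  · simp [hR]

lemma colSum_two_filled {α β : ℝ} {R : Set ℕ} {n : ℕ} (h2 : n + 2 ∈ R) (h3 : n + 3 ∈ R) (x : ℝ) :
    colSum α β R (n + 1) (fun C₂ => colSum α β (remaining R C₂) (n + 2) fun C₁ =>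
        filled C₁ (n + 1) * x ^ count (n + 3) (remaining (remaining R C₂) C₁)) =
      if n + 1 ∈ R then β * (β + α * x) * ((β + α * (x + β)) * (x + β + β) ^ count n R +
          α * β * (x + β) ^ count n R) else 0 := by
  rw [colSum_congr fun C hC =>
    colSum_filled_mul_pow_count (mem_remaining_of_mem_cols hC (by omega) h3) x, colSum_mul_left,
    colSum_eq h2]
  have hβ := openSum_ite_mem_remaining_mul_pow_count α β R n (x + β)
  have hc : (fun C => (if n + 2 ∈ remaining R (update C (n + 1 + 1) .beta) then x + β else 1) *
      if n + 1 ∈ remaining R (update C (n + 1 + 1) .beta) then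
        (β + α * x) * (x + β) ^ count n (remaining R (update C (n + 1 + 1) .beta)) else 0) =
      fun C => (β + α * x) *
        if n + 1 ∈ remaining R C then (x + β) ^ count n (remaining R C) else 0 := by
    funext C
    rw [if_neg (notMem_remaining_update_beta R C (n + 2)), count_remaining_update (by omega)]
    simp only [mem_remaining_update_of_ne (show n + 1 ≠ n + 1 + 1 by omega)]
    split_ifs <;> ring
  rw [hc, openSum_mul_left, remaining_alphaCol, if_pos h2]
  split_ifs at hβ ⊢ with h1
  · linear_combination β * (β + α * x) * hβ
  · linear_combination β * (β + α * x) * hβ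

lemma colSum_ite_mem_remaining {α β : ℝ} {R : Set ℕ} {n : ℕ} (hR : n + 1 ∈ R) (f : ℕ → ℝ) :
    colSum α β R n (fun C => if n + 1 ∈ remaining R C then f (count n (remaining R C)) else 0) =
      α * f (count n R) := by
  simp [colSum_eq hR, notMem_remaining_update_beta, remaining_alphaCol, hR, openSum]

/-- Total weight of three consecutive columns such that the third box from below in the last one
is nonempty. -/
lemma colSum_three_filled {α β : ℝ} {R : Set ℕ} {n : ℕ} (hR : ∀ i, n < i → i ∈ R) (x : ℝ) :
    colSum α β R n (fun C₃ => colSum α β (remaining R C₃) (n + 1) fun C₂ =>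
      colSum α β (remaining (remaining R C₃) C₂) (n + 2) fun C₁ =>
        filled C₁ (n + 1) *
          x ^ count (n + 3) (remaining (remaining (remaining R C₃) C₂) C₁)) =
    α * β * ((β + α * x) * (β + α * (x + β))) * (x + β + β) ^ count n R +
      (α * β) ^ 2 * (β + α * x) * (x + β) ^ count n R := by
  rw [colSum_congr fun C hC => colSum_two_filled
    (mem_remaining_of_mem_cols hC (by omega) (hR (n + 2) (by omega)))
    (mem_remaining_of_mem_cols hC (by omega) (hR (n + 3) (by omega))) x,
    colSum_ite_mem_remaining (hR (n + 1) (by omega)) fun r =>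
      β * (β + α * x) * ((β + α * (x + β)) * (x + β + β) ^ r + α * β * (x + β) ^ r)]
  ring

lemma colSum_two_filled_filled {α β : ℝ} {R : Set ℕ} {n : ℕ} (h3 : n + 3 ∈ R) (h4 : n + 4 ∈ R)
    (x : ℝ) :
    colSum α β R (n + 2) (fun C₂ => colSum α β (remaining R C₂) (n + 3) fun C₁ =>
        filled C₁ (n + 2) * filled C₂ (n + 1) *
          x ^ count (n + 4) (remaining (remaining R C₂) C₁)) =
      if n + 2 ∈ R then if n + 1 ∈ R then
        β ^ 2 * ((β + α * x) * (β + α * (x + β))) * (x + β + β) ^ count n R else 0 else 0 := by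
  have h1 : ∀ C₂ ∈ cols R (n + 3), (colSum α β (remaining R C₂) (n + 3) fun C₁ =>
        filled C₁ (n + 2) * filled C₂ (n + 1) *
          x ^ count (n + 4) (remaining (remaining R C₂) C₁)) =
      β * (filled C₂ (n + 1) * ((if n + 3 ∈ remaining R C₂ then x + β else 1) *
        if n + 2 ∈ remaining R C₂ then
          (β + α * x) * (x + β) ^ count (n + 1) (remaining R C₂) else 0)) := by
    intro C₂ hC₂
    have := colSum_filled_mul_pow_count (α := α) (β := β)
      (mem_remaining_of_mem_cols hC₂ (show n + 3 < n + 4 by omega) h4) x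
    calc _ = filled C₂ (n + 1) * colSum α β (remaining R C₂) (n + 3) (fun C₁ =>
        filled C₁ (n + 2) * x ^ count (n + 4) (remaining (remaining R C₂) C₁)) := by
          rw [← colSum_mul_left]
          exact colSum_congr fun C _ => by ring
      _ = _ := by rw [this]; ring
  rw [colSum_congr h1, colSum_mul_left, colSum_eq h3, filled_alphaCol_of_ne (by omega)]
  have h2 : openSum α β R (n + 2) (fun C => filled (update C (n + 2 + 1) .beta) (n + 1) *
      ((if n + 3 ∈ remaining R (update C (n + 2 + 1) .beta) then x + β else 1) *
        if n + 2 ∈ remaining R (update C (n + 2 + 1) .beta) then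
          (β + α * x) * (x + β) ^ count (n + 1) (remaining R (update C (n + 2 + 1) .beta))
        else 0)) =
      if n + 2 ∈ R then (β + α * x) * openSum α β R (n + 1) (fun C => filled C (n + 1) *
        (x + β) ^ count (n + 1) (remaining R C)) else 0 := by
    simp only [filled_update_of_ne (show n + 1 ≠ n + 2 + 1 by omega),
      notMem_remaining_update_beta, if_false, one_mul,
      count_remaining_update (show n + 1 < n + 2 + 1 by omega),
      mem_remaining_update_of_ne (show n + 2 ≠ n + 2 + 1 by omega)]
    have h0 : ∀ C ∈ openCols R (n + 1), (filled C (n + 1) *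
        if n + 2 ∈ remaining R C then
          (β + α * x) * (x + β) ^ count (n + 1) (remaining R C) else 0) =
        (if n + 2 ∈ R then β + α * x else 0) * (filled C (n + 1) *
          (x + β) ^ count (n + 1) (remaining R C)) := by
      intro C hC
      simp only [mem_remaining, openCols_eq_empty hC (show n + 1 < n + 2 by omega)]
      split_ifs <;> simp_all; ring
    rw [openSum_succ, openSum_congr h0, openSum_mul_left]
    simp only [notMem_remaining_update_beta, if_false, mul_zero,
      filled_alphaCol_of_ne (show n + 1 ≠ n + 1 + 1 by omega)]
    split_ifs <;> simp [openSum]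
  rw [h2, openSum_filled_mul_pow_count]
  split_ifs <;> ring

/-- Total weight of four consecutive columns such that the third boxes from below in the last two
are nonempty. -/
lemma colSum_four_filled_filled {α β : ℝ} {R : Set ℕ} {n : ℕ} (hR : ∀ i, n < i → i ∈ R) (x : ℝ) :
    colSum α β R n (fun C₄ => colSum α β (remaining R C₄) (n + 1) fun C₃ =>
      colSum α β (remaining (remaining R C₄) C₃) (n + 2) fun C₂ =>
      colSum α β (remaining (remaining (remaining R C₄) C₃) C₂) (n + 3) fun C₁ =>
        filled C₁ (n + 2) * filled C₂ (n + 1) *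
          x ^ count (n + 4) (remaining (remaining (remaining (remaining R C₄) C₃) C₂) C₁)) =
    (α * β) ^ 2 * ((β + α * x) * (β + α * (x + β))) * (x + β + β) ^ count n R := by
  have h : ∀ C₄ ∈ cols R (n + 1), (colSum α β (remaining R C₄) (n + 1) fun C₃ =>
      colSum α β (remaining (remaining R C₄) C₃) (n + 2) fun C₂ =>
      colSum α β (remaining (remaining (remaining R C₄) C₃) C₂) (n + 3) fun C₁ =>
        filled C₁ (n + 2) * filled C₂ (n + 1) *
          x ^ count (n + 4) (remaining (remaining (remaining (remaining R C₄) C₃) C₂) C₁)) =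
      if n + 1 ∈ remaining R C₄ then α * (β ^ 2 * ((β + α * x) * (β + α * (x + β))) *
        (x + β + β) ^ count n (remaining R C₄)) else 0 := by
    intro C₄ hC₄
    have hR' : ∀ i, n + 1 < i → i ∈ remaining R C₄ := fun i hi =>
      mem_remaining_of_mem_cols hC₄ hi (hR i (by omega))
    rw [colSum_congr fun C hC => colSum_two_filled_filled
      (mem_remaining_of_mem_cols hC (by omega) (hR' (n + 3) (by omega)))
      (mem_remaining_of_mem_cols hC (by omega) (hR' (n + 4) (by omega))) x,
      colSum_eq (hR' (n + 2) (by omega))]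
    simp only [remaining_alphaCol, notMem_remaining_update_beta, if_false, openSum, mul_zero,
      sum_const_zero, add_zero, hR' (n + 2) (by omega), if_true]
    split_ifs <;> ring
  rw [colSum_congr h, colSum_ite_mem_remaining (hR (n + 1) (by omega)) fun r =>
      α * (β ^ 2 * ((β + α * x) * (β + α * (x + β))) * (x + β + β) ^ r)]
  ring

/-- Prepend the column `C` to the tableau `S`. -/
def addCol (C : ℕ → StairSymb) (S : ℕ → ℕ → StairSymb) : ℕ → ℕ → StairSymb
  | _, 0 => .empty
  | i, 1 => C i
  | i, j + 2 => S i (j + 1)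

/-- The rows containing no `β`. -/
def freeRows (S : ℕ → ℕ → StairSymb) : Set ℕ := {i | ∀ j, S i j ≠ .beta}

/-- The staircase tableaux of size `n`, built column by column from the right. -/
noncomputable def tableaux : ℕ → Finset (ℕ → ℕ → StairSymb)
  | 0 => {fun _ _ => .empty}
  | n + 1 => (tableaux n).biUnion fun S =>
      (cols (freeRows S) (n + 1)).image fun C => addCol C S

lemma mem_cols {R : Set ℕ} {m : ℕ} {C : ℕ → StairSymb} :
    C ∈ cols R m ↔ (∀ i, C i ≠ .empty → 1 ≤ i ∧ i ≤ m ∧ i ∈ R) ∧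
      (∀ i i', i < i' → C i' = .alpha → C i = .empty) ∧ C m ≠ .empty := by
  rw [cols, mem_filter, mem_openCols, and_assoc]

lemma _root_.IsStaircase.eq_empty_of_zero {n : ℕ} {S : ℕ → ℕ → StairSymb} (hS : IsStaircase n S)
    (i : ℕ) : S i 0 = .empty := hS.1 i 0 (by omega)

lemma isStaircase_addCol {n : ℕ} {C : ℕ → StairSymb} {S : ℕ → ℕ → StairSymb}
    (hS : IsStaircase n S) (hC : C ∈ cols (freeRows S) (n + 1)) :
    IsStaircase (n + 1) (addCol C S) := by
  obtain ⟨h1, h2, h3⟩ := mem_cols.1 hC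
  obtain ⟨s1, s2, s3, s4⟩ := hS
  refine ⟨?_, ?_, ?_, ?_⟩
  · rintro i (_ | _ | j) h
    · rfl
    · by_contra hne
      have := h1 i hne
      omega
    · exact s1 i (j + 1) (by omega)
  · rintro i i' (_ | _ | j) hi hii' hj hle ha
    · rfl
    · exact h2 i i' hii' ha
    · exact s2 i i' (j + 1) hi hii' (by omega) (by omega) ha
  · rintro i (_ | _ | j) (_ | _ | j') hi hj hjj' hle hb
    all_goals first | omega | skip
    · by_contra hne
      exact (h1 i hne).2.2 (j' + 1) hb
    · exact s3 i (j + 1) (j' + 1) hi (by omega) (by omega) (by omega) hb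
  · rintro i (_ | _ | j) hi hj hij
    · omega
    · have : i = n + 1 := by omega
      subst this
      exact h3
    · exact s4 i (j + 1) hi (by omega) (by omega)

lemma _root_.IsStaircase.exists_eq_addCol {n : ℕ} {S : ℕ → ℕ → StairSymb}
    (hS : IsStaircase (n + 1) S) :
    ∃ S', IsStaircase n S' ∧ ∃ C ∈ cols (freeRows S') (n + 1), addCol C S' = S := by
  obtain ⟨s1, s2, s3, s4⟩ := hS
  refine ⟨fun i j => if j = 0 then .empty else S i (j + 1), ⟨?_, ?_, ?_, ?_⟩,
    fun i => S i 1, mem_cols.2 ⟨?_, ?_, ?_⟩, ?_⟩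
  · intro i j h
    dsimp only
    split_ifs
    · rfl
    · exact s1 i (j + 1) (by omega)
  · intro i i' j hi hii' hj hle ha
    dsimp only at ha ⊢
    rw [if_neg (by omega)] at ha ⊢
    exact s2 i i' (j + 1) hi hii' (by omega) (by omega) ha
  · intro i j j' hi hj hjj' hle hb
    dsimp only at hb ⊢
    rw [if_neg (by omega)] at hb ⊢
    exact s3 i (j + 1) (j' + 1) hi (by omega) (by omega) (by omega) hb
  · intro i j hi hj hij
    dsimp only
    rw [if_neg (by omega)]
    exact s4 i (j + 1) hi (by omega) (by omega)
  · intro i hne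
    have hi : 1 ≤ i ∧ 1 ≤ 1 ∧ i + 1 ≤ n + 1 + 1 := by
      by_contra h
      exact hne (s1 i 1 h)
    refine ⟨hi.1, by omega, fun j hj => ?_⟩
    dsimp only at hj
    split_ifs at hj with hj0
    have hb : 1 ≤ i ∧ 1 ≤ j + 1 ∧ i + (j + 1) ≤ n + 1 + 1 := by
      by_contra h
      rw [s1 i (j + 1) h] at hj
      cases hj
    exact hne (s3 i 1 (j + 1) hi.1 le_rfl (by omega) hb.2.2 hj)
  · intro i i' hii' ha
    by_cases hi : 1 ≤ i
    · have hb : 1 ≤ i' ∧ 1 ≤ 1 ∧ i' + 1 ≤ n + 1 + 1 := by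
        by_contra h
        rw [s1 i' 1 h] at ha
        cases ha
      exact s2 i i' 1 hi hii' le_rfl hb.2.2 ha
    · exact s1 i 1 (by omega)
  · exact s4 (n + 1) 1 (by omega) le_rfl rfl
  · funext i j
    rcases j with _ | _ | j
    · exact (s1 i 0 (by omega)).symm
    · rfl
    · simp [addCol]

lemma mem_tableaux {n : ℕ} {S : ℕ → ℕ → StairSymb} : S ∈ tableaux n ↔ IsStaircase n S := by
  induction n generalizing S with
  | zero =>
    rw [tableaux, mem_singleton]
    constructor
    · rintro rfl
      exact ⟨fun _ _ _ => rfl, fun _ _ _ _ _ _ _ _ => rfl, fun _ _ _ _ _ _ _ _ => rfl,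
        fun i j hi hj hij => by omega⟩
    · intro h
      funext i j
      exact h.1 i j (by omega)
  | succ n ih =>
    simp only [tableaux, mem_biUnion, mem_image, ih]
    constructor
    · rintro ⟨S', hS', C, hC, rfl⟩
      exact isStaircase_addCol hS' hC
    · exact fun h => h.exists_eq_addCol

lemma freeRows_addCol {C : ℕ → StairSymb} {S : ℕ → ℕ → StairSymb} (hS : ∀ i, S i 0 = .empty) :
    freeRows (addCol C S) = remaining (freeRows S) C := by
  ext i
  constructor
  · intro h
    refine ⟨fun j => ?_, h 1⟩
    rcases j with _ | j
    · simp [hS]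
    · exact h (j + 2)
  · rintro ⟨h1, h2⟩ (_ | _ | j)
    · simp [addCol]
    · exact h2
    · exact h1 (j + 1)

lemma mem_freeRows_of_lt {n i : ℕ} {S : ℕ → ℕ → StairSymb} (hS : S ∈ tableaux n) (hi : n < i) :
    i ∈ freeRows S := by
  intro j
  rw [(mem_tableaux.1 hS).1 i j (by omega)]
  simp

lemma addCol_injective (S : ℕ → ℕ → StairSymb) : Injective fun C => addCol C S :=
  fun _ _ h => funext fun i => congrFun (congrFun h i) 1

lemma finite_setOf_eq {n : ℕ} {S : ℕ → ℕ → StairSymb} (hS : IsStaircase n S) {s : StairSymb}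
    (hs : s ≠ .empty) : {p : ℕ × ℕ | S p.1 p.2 = s}.Finite := by
  refine ((Set.finite_Iic (n + 1)).prod (Set.finite_Iic (n + 1))).subset ?_
  rintro ⟨i, j⟩ h
  by_contra hne
  simp only [Set.mem_prod, Set.mem_Iic] at hne
  exact hs (h.symm.trans (hS.1 i j (by omega)))

lemma ncard_addCol {n : ℕ} {C : ℕ → StairSymb} {S : ℕ → ℕ → StairSymb} (hS : IsStaircase n S)
    (hC : ∀ i, C i ≠ .empty → 1 ≤ i ∧ i ≤ n + 1) {s : StairSymb} (hs : s ≠ .empty) :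
    {p : ℕ × ℕ | addCol C S p.1 p.2 = s}.ncard =
      ((Icc 1 (n + 1)).filter fun i => C i = s).card + {p : ℕ × ℕ | S p.1 p.2 = s}.ncard := by
  have heq : {p : ℕ × ℕ | addCol C S p.1 p.2 = s} =
      (fun i => (i, 1)) '' (((Icc 1 (n + 1)).filter fun i => C i = s : Finset ℕ) : Set ℕ) ∪
        (fun p : ℕ × ℕ => (p.1, p.2 + 1)) '' {p : ℕ × ℕ | S p.1 p.2 = s} := by
    ext ⟨i, j⟩
    simp only [Set.mem_ofPred_eq, Set.mem_union, Set.mem_image, coe_filter, mem_Icc, Prod.mk.injEq,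
      Prod.exists]
    constructor
    · intro h
      rcases j with _ | _ | j
      · exact absurd h hs.symm
      · exact .inl ⟨i, ⟨hC i (by rw [show C i = s from h]; exact hs), h⟩, rfl, rfl⟩
      · exact .inr ⟨i, j + 1, h, rfl, rfl⟩
    · rintro (⟨i', ⟨-, h⟩, rfl, rfl⟩ | ⟨i', j', h, rfl, rfl⟩)
      · exact h
      · rcases j' with _ | j'
        · rw [hS.eq_empty_of_zero] at h
          exact absurd h hs.symm
        · exact h
  have hd : Disjoint ((fun i => (i, 1)) ''
      (((Icc 1 (n + 1)).filter fun i => C i = s : Finset ℕ) : Set ℕ))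
      ((fun p : ℕ × ℕ => (p.1, p.2 + 1)) '' {p : ℕ × ℕ | S p.1 p.2 = s}) := by
    rw [Set.disjoint_left]
    rintro _ ⟨i, -, rfl⟩ ⟨⟨i', j'⟩, h, h'⟩
    simp only [Prod.mk.injEq] at h'
    have hj : j' = 0 := by omega
    subst hj
    exact hs (h.symm.trans (hS.eq_empty_of_zero i'))
  rw [heq, Set.ncard_union_eq hd ((finite_toSet _).image _) ((finite_setOf_eq hS hs).image _),
    Set.ncard_image_of_injective, Set.ncard_coe_finset, Set.ncard_image_of_injective]
  · rintro ⟨a, b⟩ ⟨c, d⟩ h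
    simpa using h
  · intro a b h
    simpa using h

lemma colWt_eq (α β : ℝ) (m : ℕ) (C : ℕ → StairSymb) :
    colWt α β m C = α ^ ((Icc 1 m).filter fun i => C i = .alpha).card *
      β ^ ((Icc 1 m).filter fun i => C i = .beta).card := by
  rw [colWt, ← prod_const, ← prod_const, prod_filter, prod_filter, ← prod_mul_distrib]
  refine prod_congr rfl fun i _ => ?_
  cases C i <;> simp [symbWt]

lemma stairWt_addCol (α β : ℝ) {n : ℕ} {C : ℕ → StairSymb} {S : ℕ → ℕ → StairSymb}
    (hS : S ∈ tableaux n) (hC : C ∈ cols (freeRows S) (n + 1)) :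
    stairWt α β (addCol C S) = stairWt α β S * colWt α β (n + 1) C := by
  rw [mem_tableaux] at hS
  have hC' : ∀ i, C i ≠ .empty → 1 ≤ i ∧ i ≤ n + 1 := fun i hi =>
    ⟨((mem_cols.1 hC).1 i hi).1, ((mem_cols.1 hC).1 i hi).2.1⟩
  rw [stairWt, ncard_addCol hS hC' (by simp), ncard_addCol hS hC' (by simp), colWt_eq, stairWt]
  ring

/-- Weighted sums over tableaux of size `n + 1`, computed by first summing over the leftmost
column. -/
lemma sum_tableaux_succ (α β : ℝ) (n : ℕ) (Ψ : (ℕ → ℕ → StairSymb) → ℝ) :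
    ∑ S ∈ tableaux (n + 1), stairWt α β S * Ψ S =
      ∑ S ∈ tableaux n, stairWt α β S *
        colSum α β (freeRows S) n (fun C => Ψ (addCol C S)) := by
  rw [tableaux, sum_biUnion]
  · refine sum_congr rfl fun S hS => ?_
    rw [sum_image (addCol_injective S).injOn, colSum, mul_sum]
    refine sum_congr rfl fun C hC => ?_
    rw [stairWt_addCol α β hS hC, mul_assoc]
  · intro S hS S' hS' hne
    rw [Function.onFun, disjoint_left]
    intro T hT hT'
    obtain ⟨C, -, rfl⟩ := mem_image.1 hT
    obtain ⟨C', -, h⟩ := mem_image.1 hT'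
    refine hne ?_
    funext i j
    rcases j with _ | j
    · rw [(mem_tableaux.1 hS).eq_empty_of_zero, (mem_tableaux.1 hS').eq_empty_of_zero]
    · exact (congrFun (congrFun h i) (j + 2)).symm

lemma finsum_isStaircase (n : ℕ) (E : (ℕ → ℕ → StairSymb) → Prop)
    (f : (ℕ → ℕ → StairSymb) → ℝ) :
    ∑ᶠ S ∈ {S : ℕ → ℕ → StairSymb | IsStaircase n S ∧ E S}, f S =
      ∑ S ∈ (tableaux n).filter E, f S := by
  rw [← finsum_mem_coe_finset]
  congr! 4
  simp [mem_tableaux]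

lemma stairZ_eq (n : ℕ) (α β : ℝ) : stairZ n α β = ∑ S ∈ tableaux n, stairWt α β S := by
  simpa [stairZ] using finsum_isStaircase n (fun _ => True) (stairWt α β)

/-- The number of nonempty boxes on the third main diagonal, among those strictly to the right of
column `k`. -/
def thirdDiag (n k : ℕ) (S : ℕ → ℕ → StairSymb) : ℕ :=
  ((Icc (k + 1) (n - 2)).filter fun j => S (n - j - 1) j ≠ .empty).card

lemma thirdDiag_addCol (n k : ℕ) (C : ℕ → StairSymb) (S : ℕ → ℕ → StairSymb) :
    thirdDiag (n + 1) (k + 1) (addCol C S) = thirdDiag n k S := by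
  symm
  refine card_bij (fun j _ => j + 1) ?_ (fun _ _ _ _ h => by simpa using h) ?_
  · intro j hj
    rw [mem_filter, mem_Icc] at hj ⊢
    obtain ⟨j, rfl⟩ : ∃ j', j = j' + 1 := ⟨j - 1, by omega⟩
    refine ⟨by omega, ?_⟩
    rw [show n + 1 - (j + 1 + 1) - 1 = n - (j + 1) - 1 by omega]
    exact hj.2
  · intro j hj
    rw [mem_filter, mem_Icc] at hj
    obtain ⟨j, rfl⟩ : ∃ j', j = j' + 2 := ⟨j - 2, by omega⟩
    refine ⟨j + 1, ?_, rfl⟩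
    rw [mem_filter, mem_Icc]
    refine ⟨by omega, ?_⟩
    rw [show n - (j + 1) - 1 = n + 1 - (j + 2) - 1 by omega]
    exact hj.2

lemma thirdDiag_eq_succ {n k : ℕ} (h : k + 1 ≤ n - 2) (S : ℕ → ℕ → StairSymb) :
    thirdDiag n k S =
      thirdDiag n (k + 1) S + if S (n - (k + 1) - 1) (k + 1) = .empty then 0 else 1 := by
  rw [thirdDiag, ← insert_Icc_add_one_left_eq_Icc h, filter_insert]
  by_cases h1 : S (n - (k + 1) - 1) (k + 1) = .empty
  · rw [if_neg (not_not.2 h1), if_pos h1]; rfl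
  · rw [if_pos h1, if_neg h1, card_insert_of_notMem (by simp)]; rfl

lemma thirdDiag_eq_of_lt {n k : ℕ} (h : n - 2 < k + 1) (S : ℕ → ℕ → StairSymb) :
    thirdDiag n k S = 0 := by
  rw [thirdDiag, Icc_eq_empty (by omega), filter_empty, card_empty]

lemma thirdDiag_succ_le (n k : ℕ) (S : ℕ → ℕ → StairSymb) :
    thirdDiag n (k + 1) S ≤ thirdDiag n k S := by
  by_cases h : k + 1 ≤ n - 2
  · rw [thirdDiag_eq_succ h]; exact Nat.le_add_right _ _
  · rw [thirdDiag_eq_of_lt (by omega)]; exact Nat.zero_le _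

lemma thirdDiag_eq_succ_of_empty {n k : ℕ} {S : ℕ → ℕ → StairSymb}
    (h : S (n - (k + 1) - 1) (k + 1) = .empty) : thirdDiag n k S = thirdDiag n (k + 1) S := by
  by_cases hk : k + 1 ≤ n - 2
  · rw [thirdDiag_eq_succ hk, if_pos h, add_zero]
  · rw [thirdDiag_eq_of_lt (by omega), thirdDiag_eq_of_lt (by omega)]

/-- The generating function of tableaux of size `n`, by free rows (`x`) and nonempty boxes on the
third main diagonal (`y`). -/
noncomputable def genFun (α β y : ℝ) (n : ℕ) (x : ℝ) : ℝ :=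
  ∑ S ∈ tableaux n, stairWt α β S * (x ^ count n (freeRows S) * y ^ thirdDiag n 0 S)

lemma freeRows_addCol_of_mem {n : ℕ} {S : ℕ → ℕ → StairSymb} (hS : S ∈ tableaux n)
    (C : ℕ → StairSymb) : freeRows (addCol C S) = remaining (freeRows S) C :=
  freeRows_addCol (mem_tableaux.1 hS).eq_empty_of_zero

lemma freeRows_addCol_addCol (C C' : ℕ → StairSymb) (S : ℕ → ℕ → StairSymb) :
    freeRows (addCol C (addCol C' S)) = remaining (freeRows (addCol C' S)) C :=
  freeRows_addCol fun _ => rfl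

lemma sum_pow_thirdDiag_one (α β y : ℝ) (n : ℕ) (x : ℝ) :
    ∑ S ∈ tableaux (n + 1),
        stairWt α β S * (x ^ count (n + 1) (freeRows S) * y ^ thirdDiag (n + 1) 1 S) =
      (β + α * x) * genFun α β y n (x + β) := by
  rw [sum_tableaux_succ, genFun, mul_sum]
  refine sum_congr rfl fun S hS => ?_
  simp only [freeRows_addCol_of_mem hS, thirdDiag_addCol, colSum_mul_right,
    colSum_pow_count (mem_freeRows_of_lt hS (Nat.lt_succ_self n))]
  ring

lemma sum_filled_pow_thirdDiag (α β y : ℝ) (n : ℕ) (x : ℝ) :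
    ∑ S ∈ tableaux (n + 3), stairWt α β S * (filled (fun i => S i 1) (n + 1) *
        x ^ count (n + 3) (freeRows S) * y ^ thirdDiag (n + 3) 3 S) =
      α * β * ((β + α * x) * (β + α * (x + β))) * genFun α β y n (x + β + β) +
        (α * β) ^ 2 * (β + α * x) * genFun α β y n (x + β) := by
  rw [sum_tableaux_succ, sum_tableaux_succ, sum_tableaux_succ, genFun, genFun, mul_sum, mul_sum,
    ← sum_add_distrib]
  refine sum_congr rfl fun S hS => ?_
  have h := colSum_three_filled (α := α) (β := β)
    (fun i hi => mem_freeRows_of_lt hS hi : ∀ i, n < i → i ∈ freeRows S) x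
  simp only [freeRows_addCol_addCol, freeRows_addCol_of_mem hS, thirdDiag_addCol,
    colSum_mul_right]
  simp only [addCol, h]
  ring

lemma sum_filled_filled (α β : ℝ) (n : ℕ) (x : ℝ) :
    ∑ S ∈ tableaux (n + 4), stairWt α β S * (filled (fun i => S i 1) (n + 2) *
        filled (fun i => S i 2) (n + 1) * x ^ count (n + 4) (freeRows S)) =
      (α * β) ^ 2 * ((β + α * x) * (β + α * (x + β))) * genFun α β 1 n (x + β + β) := by
  rw [sum_tableaux_succ, sum_tableaux_succ, sum_tableaux_succ, sum_tableaux_succ, genFun, mul_sum]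
  refine sum_congr rfl fun S hS => ?_
  have h := colSum_four_filled_filled (α := α) (β := β)
    (fun i hi => mem_freeRows_of_lt hS hi : ∀ i, n < i → i ∈ freeRows S) x
  simp only [freeRows_addCol_addCol, freeRows_addCol_of_mem hS]
  simp only [addCol, h]
  ring

lemma sum_filled_filled_zero (α β x : ℝ) :
    ∑ S ∈ tableaux 3, stairWt α β S * (filled (fun i => S i 1) 1 *
        filled (fun i => S i 2) 0 * x ^ count 3 (freeRows S)) = 0 := by
  refine sum_eq_zero fun S hS => ?_
  simp [filled, (mem_tableaux.1 hS).1 0 2 (by omega)]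

lemma genFun_zero (α β y x : ℝ) : genFun α β y 0 x = 1 := by
  simp [genFun, tableaux, stairWt, count, thirdDiag]

lemma genFun_succ_of_thirdDiag_eq_zero {n : ℕ} (hn : n < 2) (α β y x : ℝ) :
    genFun α β y (n + 1) x = (β + α * x) * genFun α β y n (x + β) := by
  rw [← sum_pow_thirdDiag_one, genFun]
  refine sum_congr rfl fun S _ => ?_
  rw [thirdDiag_eq_of_lt (by omega), thirdDiag_eq_of_lt (by omega)]

lemma genFun_one_succ (α β : ℝ) (n : ℕ) (x : ℝ) :
    genFun α β 1 (n + 1) x = (β + α * x) * genFun α β 1 n (x + β) := by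
  rw [← sum_pow_thirdDiag_one]
  simp [genFun]

lemma _root_.IsStaircase.third_diag_eq_empty {n : ℕ} {S : ℕ → ℕ → StairSymb}
    (hS : IsStaircase (n + 3) S) (h : S (n + 1) 1 ≠ .empty) : S (n - 1) 3 = .empty := by
  obtain ⟨s1, s2, s3, s4⟩ := hS
  by_cases hn : 1 ≤ n - 1
  · cases hd : S (n + 1) 3 with
    | empty => exact absurd hd (s4 _ _ (by omega) (by omega) (by omega))
    | alpha => exact s2 (n - 1) (n + 1) 3 hn (by omega) (by omega) (by omega) hd
    | beta => exact absurd (s3 (n + 1) 1 3 (by omega) le_rfl (by omega) (by omega) hd) h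
  · exact s1 _ _ (by omega)

lemma stairWt_nonneg {α β : ℝ} (hα : 0 < α) (hβ : 0 < β) (S : ℕ → ℕ → StairSymb) :
    0 ≤ stairWt α β S := by unfold stairWt; positivity

/-- The recursion for `genFun`, up to the contribution of tableaux with two adjacent nonempty
boxes on the third main diagonal. -/
lemma abs_genFun_sub_le {α β y x : ℝ} (hα : 0 < α) (hβ : 0 < β) (hy0 : 0 ≤ y) (hy1 : y ≤ 1)
    (hx : 0 < x) (n : ℕ) :
    |genFun α β y (n + 3) x - (β + α * x) * genFun α β y (n + 2) (x + β) - (y - 1) *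
        (α * β * ((β + α * x) * (β + α * (x + β))) * genFun α β y n (x + β + β) +
          (α * β) ^ 2 * (β + α * x) * genFun α β y n (x + β))| ≤
      ∑ S ∈ tableaux (n + 3), stairWt α β S * (filled (fun i => S i 1) (n + 1) *
        filled (fun i => S i 2) n * x ^ count (n + 3) (freeRows S)) := by
  rw [← sum_pow_thirdDiag_one, ← sum_filled_pow_thirdDiag, genFun, mul_sum, ← sum_sub_distrib,
    ← sum_sub_distrib]
  refine (abs_sum_le_sum_abs _ _).trans (sum_le_sum fun S hS => ?_)
  have hw := stairWt_nonneg hα hβ S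
  have hxc : 0 ≤ x ^ count (n + 3) (freeRows S) := by positivity
  have h0 := thirdDiag_eq_succ (n := n + 3) (k := 0) (by omega) S
  rw [show n + 3 - (0 + 1) - 1 = n + 1 by omega, zero_add] at h0
  rw [h0]
  by_cases h1 : S (n + 1) 1 = .empty
  · simp [filled, h1]
  have h3 : thirdDiag (n + 3) 2 S = thirdDiag (n + 3) 3 S := by
    refine thirdDiag_eq_succ_of_empty ?_
    rw [show n + 3 - (2 + 1) - 1 = n - 1 by omega]
    exact (mem_tableaux.1 hS).third_diag_eq_empty h1
  by_cases h2 : S n 2 = .empty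
  · have h2' : thirdDiag (n + 3) 1 S = thirdDiag (n + 3) 2 S := by
      refine thirdDiag_eq_succ_of_empty ?_
      rw [show n + 3 - (1 + 1) - 1 = n by omega]
      exact h2
    rw [h2', h3]
    simp only [filled, h1, h2, if_true, if_false]
    refine le_of_eq_of_le (abs_eq_zero.2 ?_) (by simp)
    ring
  · simp only [filled, h1, h2, if_false]
    have ha : 0 ≤ y ^ thirdDiag (n + 3) 1 S := by positivity
    have hb : y ^ thirdDiag (n + 3) 3 S ≤ 1 := pow_le_one₀ hy0 hy1
    have hab : y ^ thirdDiag (n + 3) 1 S ≤ y ^ thirdDiag (n + 3) 3 S :=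
      pow_le_pow_of_le_one hy0 hy1 (h3 ▸ thirdDiag_succ_le _ _ _)
    have key : |(y - 1) * (y ^ thirdDiag (n + 3) 1 S - y ^ thirdDiag (n + 3) 3 S)| ≤ 1 := by
      rw [abs_mul]
      exact mul_le_one₀ (abs_le.2 ⟨by linarith, by linarith⟩) (abs_nonneg _)
        (abs_le.2 ⟨by linarith, by linarith⟩)
    calc _ = stairWt α β S * x ^ count (n + 3) (freeRows S) *
          |(y - 1) * (y ^ thirdDiag (n + 3) 1 S - y ^ thirdDiag (n + 3) 3 S)| := by
          conv_rhs => rw [← abs_of_nonneg (mul_nonneg hw hxc), ← abs_mul]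
          congr 1
          ring
      _ ≤ stairWt α β S * x ^ count (n + 3) (freeRows S) * 1 := by gcongr
      _ = _ := by ring

lemma genFun_one_pos {α β : ℝ} (hα : 0 < α) (hβ : 0 < β) (n : ℕ) {x : ℝ} (hx : 0 < x) :
    0 < genFun α β 1 n x := by
  induction n generalizing x with
  | zero => simp [genFun_zero]
  | succ n ih =>
    rw [genFun_one_succ]
    have := ih (x := x + β) (by positivity)
    positivity

lemma genFun_one_succ' (α β : ℝ) (n : ℕ) (x : ℝ) :
    genFun α β 1 (n + 1) x = (α * x + β + n * (α * β)) * genFun α β 1 n x := by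
  induction n generalizing x with
  | zero => simp [genFun_one_succ, genFun_zero]; ring
  | succ n ih =>
    rw [genFun_one_succ, ih, genFun_one_succ α β n x]
    push_cast
    ring

lemma genFun_nonneg {α β y x : ℝ} (hα : 0 < α) (hβ : 0 < β) (hy0 : 0 ≤ y) (hx : 0 < x) (n : ℕ) :
    0 ≤ genFun α β y n x :=
  sum_nonneg fun S _ => mul_nonneg (stairWt_nonneg hα hβ S) (by positivity)

lemma genFun_le_genFun_one {α β y x : ℝ} (hα : 0 < α) (hβ : 0 < β) (hy0 : 0 ≤ y) (hy1 : y ≤ 1)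
    (hx : 0 < x) (n : ℕ) : genFun α β y n x ≤ genFun α β 1 n x := by
  refine sum_le_sum fun S _ => mul_le_mul_of_nonneg_left ?_ (stairWt_nonneg hα hβ S)
  gcongr

/-- The generating function `genFun`, normalized by its value at `y = 1`. -/
noncomputable def pgf (α β y : ℝ) (n : ℕ) (x : ℝ) : ℝ := genFun α β y n x / genFun α β 1 n x

lemma genFun_eq_pgf_mul {α β : ℝ} (hα : 0 < α) (hβ : 0 < β) (y : ℝ) (n : ℕ) {x : ℝ}
    (hx : 0 < x) : genFun α β y n x = pgf α β y n x * genFun α β 1 n x :=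
  (div_mul_cancel₀ _ (genFun_one_pos hα hβ n hx).ne').symm

lemma abs_pgf_le_one {α β y x : ℝ} (hα : 0 < α) (hβ : 0 < β) (hy0 : 0 ≤ y) (hy1 : y ≤ 1)
    (hx : 0 < x) (n : ℕ) : |pgf α β y n x| ≤ 1 := by
  have := genFun_one_pos hα hβ n hx
  rw [pgf, abs_of_nonneg (div_nonneg (genFun_nonneg hα hβ hy0 hx n) this.le), div_le_one this]
  exact genFun_le_genFun_one hα hβ hy0 hy1 hx n

lemma pgf_zero (α β y x : ℝ) : pgf α β y 0 x = 1 := by simp [pgf, genFun_zero]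

lemma pgf_succ_of_lt {α β x : ℝ} (hα : 0 < α) (hβ : 0 < β) (hx : 0 < x) {n : ℕ} (hn : n < 2)
    (y : ℝ) : pgf α β y (n + 1) x = pgf α β y n (x + β) := by
  have : β + α * x ≠ 0 := by positivity
  rw [pgf, pgf, genFun_succ_of_thirdDiag_eq_zero hn, genFun_one_succ, mul_div_mul_left _ _ this]

lemma abs_pgf_sub_le {α β y x D : ℝ} (hα : 0 < α) (hβ : 0 < β) (hy0 : 0 ≤ y) (hy1 : y ≤ 1)
    (hx : 0 < x) (n : ℕ) (hD : D = x / β + 1 / α + n + 2) :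
    |pgf α β y (n + 3) x - pgf α β y (n + 2) (x + β) -
      (y - 1) / D * pgf α β y n (x + β + β)| ≤ 2 / (D * (D - 1)) := by
  have hD2 : 2 < D := by
    have : 0 < x / β + 1 / α := by positivity
    have : (0 : ℝ) ≤ n := by positivity
    linarith
  have hD0 : 0 < D := by linarith
  have hD1 : 0 < D - 1 := by linarith
  have hαβD : α * β * D = α * x + β + (n + 2) * (α * β) := by
    rw [hD]; field_simp; ring
  set Z₁ := genFun α β 1 (n + 1) x with hZ₁
  have hZ₁pos : 0 < Z₁ := genFun_one_pos hα hβ _ hx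
  have hZ₂ : genFun α β 1 (n + 2) x = α * β * (D - 1) * Z₁ := by
    rw [genFun_one_succ' α β (n + 1), mul_sub, hαβD]
    push_cast
    ring
  have hZ₃ : genFun α β 1 (n + 3) x = α * β * D * (α * β * (D - 1) * Z₁) := by
    rw [genFun_one_succ' α β (n + 2), hZ₂, hαβD]
    push_cast
    ring
  have e₃ : (β + α * x) * genFun α β 1 (n + 2) (x + β) = α * β * D * (α * β * (D - 1) * Z₁) := by
    rw [← hZ₃, genFun_one_succ α β (n + 2) x]
  have e₂ : (β + α * x) * (β + α * (x + β)) * genFun α β 1 n (x + β + β) =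
      α * β * (D - 1) * Z₁ := by
    rw [← hZ₂, genFun_one_succ, genFun_one_succ, mul_assoc]
  have e₁ : (β + α * x) * genFun α β 1 n (x + β) = Z₁ := by
    rw [hZ₁, genFun_one_succ]
  have hE : ∑ S ∈ tableaux (n + 3), stairWt α β S * (filled (fun i => S i 1) (n + 1) *
        filled (fun i => S i 2) n * x ^ count (n + 3) (freeRows S)) ≤ (α * β) ^ 2 * Z₁ := by
    rcases n with _ | m
    · rw [sum_filled_filled_zero]; positivity
    · rw [sum_filled_filled, hZ₁, genFun_one_succ, genFun_one_succ]
      exact le_of_eq (by ring)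
  have h := (abs_genFun_sub_le hα hβ hy0 hy1 hx n).trans hE
  set r := pgf α β y n (x + β)
  have hr : |r| ≤ 1 := abs_pgf_le_one hα hβ hy0 hy1 (by positivity) n
  rw [genFun_eq_pgf_mul hα hβ y (n + 3) hx, genFun_eq_pgf_mul hα hβ y (n + 2) (by positivity),
    genFun_eq_pgf_mul hα hβ y n (show 0 < x + β + β by positivity),
    genFun_eq_pgf_mul hα hβ y n (show 0 < x + β by positivity), hZ₃] at h
  have hfac : ∀ a b c : ℝ, a * (α * β * D * (α * β * (D - 1) * Z₁)) -
      (β + α * x) * (b * genFun α β 1 (n + 2) (x + β)) - (y - 1) *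
      (α * β * ((β + α * x) * (β + α * (x + β))) * (c * genFun α β 1 n (x + β + β)) +
        (α * β) ^ 2 * (β + α * x) * (r * genFun α β 1 n (x + β))) =
      ((α * β) ^ 2 * Z₁) * (D * (D - 1)) *
        (a - b - (y - 1) / D * c - (y - 1) * r / (D * (D - 1))) := by
    intro a b c
    have : ((α * β) ^ 2 * Z₁) * (D * (D - 1)) *
        (a - b - (y - 1) / D * c - (y - 1) * r / (D * (D - 1))) =
        ((α * β) ^ 2 * Z₁) * (D * (D - 1) * (a - b) - (y - 1) * (D - 1) * c - (y - 1) * r) := by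
      field_simp
    rw [this]
    linear_combination (-b) * e₃ - (y - 1) * (α * β) * c * e₂ - (y - 1) * (α * β) ^ 2 * r * e₁
  have hA : 0 < (α * β) ^ 2 * Z₁ := by positivity
  have hDD : 0 < D * (D - 1) := by positivity
  rw [hfac, abs_mul, abs_of_pos (mul_pos hA hDD), mul_assoc] at h
  have h' := le_of_mul_le_mul_left (h.trans_eq (mul_one _).symm) hA
  rw [← le_div_iff₀' hDD] at h'
  have hlast : |(y - 1) * r / (D * (D - 1))| ≤ 1 / (D * (D - 1)) := by
    rw [abs_div, abs_of_pos hDD, abs_mul]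
    gcongr
    exact mul_le_one₀ (abs_le.2 ⟨by linarith, by linarith⟩) (abs_nonneg _) hr
  calc _ = |(pgf α β y (n + 3) x - pgf α β y (n + 2) (x + β) -
      (y - 1) / D * pgf α β y n (x + β + β) - (y - 1) * r / (D * (D - 1))) +
        (y - 1) * r / (D * (D - 1))| := by rw [sub_add_cancel]
    _ ≤ 1 / (D * (D - 1)) + 1 / (D * (D - 1)) := (abs_add_le _ _).trans (add_le_add h' hlast)
    _ = _ := by ring

lemma abs_exp_sub_exp_le {a b : ℝ} (ha : a ≤ 0) (hb : b ≤ 0) :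
    |Real.exp a - Real.exp b| ≤ |a - b| := by
  wlog hab : b ≤ a generalizing a b
  · rw [abs_sub_comm, abs_sub_comm a]
    exact this hb ha (by linarith)
  rw [abs_of_nonneg (sub_nonneg.2 (Real.exp_le_exp.2 hab)), abs_of_nonneg (sub_nonneg.2 hab)]
  have h1 : Real.exp b = Real.exp a * Real.exp (b - a) := by rw [← Real.exp_add]; ring_nf
  have h2 := Real.add_one_le_exp (b - a)
  have h3 : Real.exp a ≤ 1 := Real.exp_le_one_iff.2 ha
  have h4 := Real.exp_pos a
  rw [h1]
  nlinarith

lemma abs_exp_step_le {z D m : ℝ} (hz0 : z ≤ 0) (hz1 : -1 ≤ z) (hm : 0 ≤ m) (hD : 2 ≤ D)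
    (hmD : m + 2 ≤ D) :
    |Real.exp (z * (m + 3) / D) - Real.exp (z * (m + 2) / D) -
      z / D * Real.exp (z * m / (D - 1))| ≤ 5 / D ^ 2 := by
  have hD0 : 0 < D := by linarith
  have hD1 : 0 < D - 1 := by linarith
  set P := Real.exp (z * (m + 2) / D) with hP
  have hP0 : z * (m + 2) / D ≤ 0 := div_nonpos_of_nonpos_of_nonneg (by nlinarith) hD0.le
  have hP1 : P ≤ 1 := Real.exp_le_one_iff.2 hP0
  have hP2 : 0 < P := Real.exp_pos _
  have hzD : |z / D| ≤ 1 / D := by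
    rw [abs_div, abs_of_pos hD0]
    gcongr
    exact abs_le.2 ⟨hz1, by linarith⟩
  have h1D : 1 / D ≤ 1 := by rw [div_le_one hD0]; linarith
  have hA : |P * (Real.exp (z / D) - 1 - z / D)| ≤ 1 / D ^ 2 := by
    rw [abs_mul, abs_of_pos hP2]
    have h := Real.abs_exp_sub_one_sub_id_le (hzD.trans h1D)
    calc P * _ ≤ 1 * (z / D) ^ 2 := mul_le_mul hP1 h (abs_nonneg _) zero_le_one
      _ = |z / D| ^ 2 := by rw [sq_abs, one_mul]
      _ ≤ (1 / D) ^ 2 := by gcongr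
      _ = _ := by ring
  have hB : |z / D * (P - Real.exp (z * m / (D - 1)))| ≤ 4 / D ^ 2 := by
    rw [abs_mul]
    have h := abs_exp_sub_exp_le hP0
      (show z * m / (D - 1) ≤ 0 from div_nonpos_of_nonpos_of_nonneg (by nlinarith) hD1.le)
    have hz : |z| ≤ 1 := abs_le.2 ⟨hz1, by linarith⟩
    have e : z * (m + 2) / D - z * m / (D - 1) = z * ((2 * D - m - 2) / (D * (D - 1))) := by
      field_simp; ring
    rw [e, abs_mul, abs_of_nonneg (a := (2 * D - m - 2) / (D * (D - 1)))
      (div_nonneg (by linarith) (by positivity))] at h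
    have h5 : (2 * D - m - 2) / (D * (D - 1)) ≤ 4 / D := by
      rw [div_le_div_iff₀ (by positivity) hD0]
      nlinarith [mul_nonneg hD0.le hm, mul_nonneg hD0.le (sub_nonneg.2 hD)]
    have h6 : (0 : ℝ) ≤ (2 * D - m - 2) / (D * (D - 1)) :=
      div_nonneg (by linarith) (by positivity)
    calc _ ≤ 1 / D * (1 * (4 / D)) := by
          gcongr
          exact h.trans (by gcongr)
      _ = _ := by ring
  have hE : Real.exp (z * (m + 3) / D) = P * Real.exp (z / D) := by
    rw [hP, ← Real.exp_add]
    congr 1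
    ring
  rw [hE]
  calc _ = |P * (Real.exp (z / D) - 1 - z / D) + z / D * (P - Real.exp (z * m / (D - 1)))| := by
        congr 1; ring
    _ ≤ 1 / D ^ 2 + 4 / D ^ 2 := (abs_add_le _ _).trans (add_le_add hA hB)
    _ = _ := by ring

lemma error_step_le {D m : ℝ} (hm : 0 ≤ m) (hD : 2 ≤ D) (hmD : m + 2 ≤ D) :
    9 * Real.exp (3 * (m + 2) / D) / D + 1 / D * (9 * Real.exp (3 * m / (D - 1)) / (D - 1)) +
      9 / D ^ 2 ≤ 9 * Real.exp (3 * (m + 3) / D) / D := by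
  have hD0 : 0 < D := by linarith
  have hD1 : 0 < D - 1 := by linarith
  set P := Real.exp (3 * (m + 2) / D) with hP
  have hP1 : 1 ≤ P := Real.one_le_exp (by positivity)
  have hQ : Real.exp (3 * m / (D - 1)) ≤ P := by
    apply Real.exp_le_exp.2
    rw [div_le_div_iff₀ hD1 hD0]
    nlinarith
  have hE : Real.exp (3 * (m + 3) / D) = P * Real.exp (3 / D) := by
    rw [hP, ← Real.exp_add]
    congr 1
    ring
  have h3 := Real.add_one_le_exp (3 / D)
  have h2 : 1 / (D - 1) ≤ 2 / D := by
    rw [div_le_div_iff₀ hD1 hD0]; linarith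
  rw [hE]
  calc _ ≤ 9 * P / D + 1 / D * (9 * P * (2 / D)) + 9 * P / D ^ 2 := by
        gcongr
        · calc _ ≤ 9 * P / (D - 1) := by gcongr
            _ = 9 * P * (1 / (D - 1)) := by ring
            _ ≤ _ := by gcongr
        · linarith
    _ = 9 * (P * (3 / D + 1)) / D := by field_simp; ring
    _ ≤ _ := by gcongr

lemma abs_pgf_sub_exp_le {α β y : ℝ} (hα : 0 < α) (hβ : 0 < β) (hy0 : 0 ≤ y) (hy1 : y ≤ 1)
    (n : ℕ) {x D : ℝ} (hx : 0 < x) (hD : D = x / β + 1 / α + n - 1) (hD1 : 1 ≤ D) :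
    |pgf α β y n x - Real.exp ((y - 1) * n / D)| ≤ 9 * Real.exp (3 * n / D) / D := by
  have hz : |y - 1| ≤ 1 := abs_le.2 ⟨by linarith, by linarith⟩
  have base : ∀ n : ℕ, n ≤ 2 → ∀ D : ℝ, 1 ≤ D →
      |1 - Real.exp ((y - 1) * n / D)| ≤ 9 * Real.exp (3 * n / D) / D := by
    intro n hn D hD1
    have hD0 : 0 < D := by linarith
    have hn' : (n : ℝ) ≤ 2 := by exact_mod_cast hn
    have h := abs_exp_sub_exp_le le_rfl (show (y - 1) * n / D ≤ 0 from
      div_nonpos_of_nonpos_of_nonneg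
        (mul_nonpos_of_nonpos_of_nonneg (by linarith) (by positivity)) hD0.le)
    rw [Real.exp_zero, zero_sub, abs_neg, abs_div, abs_mul, abs_of_pos hD0, Nat.abs_cast] at h
    refine h.trans ?_
    have : 1 ≤ Real.exp (3 * n / D) := Real.one_le_exp (by positivity)
    refine div_le_div_of_nonneg_right ?_ hD0.le
    calc |y - 1| * n ≤ 1 * 2 := by gcongr
      _ ≤ _ := by linarith
  induction n using Nat.strong_induction_on generalizing x D with
  | _ n ih =>
    match n with
    | 0 => rw [pgf_zero]; exact base 0 (by omega) D hD1
    | 1 =>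
      rw [pgf_succ_of_lt hα hβ hx (by omega), pgf_zero]
      exact base 1 (by omega) D hD1
    | 2 =>
      rw [pgf_succ_of_lt hα hβ hx (by omega), pgf_succ_of_lt hα hβ (by positivity) (by omega),
        pgf_zero]
      exact base 2 (by omega) D hD1
    | m + 3 =>
      have hpos : 0 < x / β + 1 / α := by positivity
      push_cast at hD
      have hm : (0 : ℝ) ≤ m := by positivity
      have hmD : m + 2 ≤ D := by linarith
      have hD2 : 2 ≤ D := by linarith
      have hD0 : 0 < D := by linarith
      have hD10 : 0 < D - 1 := by linarith
      have h0 := abs_pgf_sub_le (D := D) hα hβ hy0 hy1 hx m (by rw [hD]; ring)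
      have h1 := ih (m + 2) (by omega) (x := x + β) (D := D) (by positivity)
        (by rw [hD]; push_cast; field_simp; ring) hD1
      have h2 := ih m (by omega) (x := x + β + β) (D := D - 1) (by positivity)
        (by rw [hD]; field_simp; ring) (by linarith)
      have h3 := abs_exp_step_le (z := y - 1) (by linarith) (by linarith) hm hD2 hmD
      have h4 := error_step_le hm hD2 hmD
      have h5 : 2 / (D * (D - 1)) ≤ 4 / D ^ 2 := by
        rw [div_le_div_iff₀ (by positivity) (by positivity)]
        nlinarith
      have h6 : |(y - 1) / D * (pgf α β y m (x + β + β) -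
          Real.exp ((y - 1) * m / (D - 1)))| ≤
          1 / D * (9 * Real.exp (3 * m / (D - 1)) / (D - 1)) := by
        rw [abs_mul, abs_div, abs_of_pos hD0]
        gcongr
      push_cast at h1 ⊢
      have h7 : 9 / D ^ 2 = 4 / D ^ 2 + 5 / D ^ 2 := by ring
      rw [abs_le] at *
      constructor <;> nlinarith

lemma tendsto_pgf {α β y : ℝ} (hα : 0 < α) (hβ : 0 < β) (hy0 : 0 ≤ y) (hy1 : y ≤ 1) :
    Filter.Tendsto (fun n : ℕ => pgf α β y n 1) Filter.atTop (nhds (Real.exp (y - 1))) := by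
  set δ := 1 / β + 1 / α - 1 with hδ
  have hn : Filter.Tendsto (fun n : ℕ => (n : ℝ) + δ) Filter.atTop Filter.atTop :=
    Filter.tendsto_atTop_add_const_right _ _ tendsto_natCast_atTop_atTop
  have hratio : Filter.Tendsto (fun n : ℕ => (n : ℝ) / (n + δ)) Filter.atTop (nhds 1) := by
    have h : Filter.Tendsto (fun n : ℕ => 1 - δ / (n + δ)) Filter.atTop (nhds (1 - 0)) :=
      tendsto_const_nhds.sub (hn.const_div_atTop δ)
    rw [sub_zero] at h
    refine h.congr' ?_
    filter_upwards [hn.eventually_ge_atTop 1] with n hn1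
    have : (n : ℝ) + δ ≠ 0 := by linarith
    field_simp
    ring
  have hexp : Filter.Tendsto (fun n : ℕ => Real.exp ((y - 1) * n / (n + δ))) Filter.atTop
      (nhds (Real.exp (y - 1))) := by
    have h := (Real.continuous_exp.tendsto _).comp (hratio.const_mul (y - 1))
    rw [mul_one] at h
    refine h.congr fun n => ?_
    simp [mul_div_assoc]
  have herr : Filter.Tendsto (fun n : ℕ => 9 * Real.exp (3 * n / (n + δ)) / (n + δ))
      Filter.atTop (nhds 0) := by
    have h := (((Real.continuous_exp.tendsto _).comp (hratio.const_mul 3)).const_mul 9).div_atTop hn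
    refine h.congr fun n => ?_
    simp [mul_div_assoc]
  have hdiff : Filter.Tendsto
      (fun n : ℕ => pgf α β y n 1 - Real.exp ((y - 1) * n / (n + δ))) Filter.atTop (nhds 0) := by
    refine squeeze_zero_norm' ?_ herr
    filter_upwards [hn.eventually_ge_atTop 1] with n hn1
    exact abs_pgf_sub_exp_le hα hβ hy0 hy1 n one_pos (by rw [hδ]; ring) hn1
  simpa using hdiff.add hexp

/-- A coefficient of a generating function of total mass at most `1` is determined, up to an error
of order `y ^ (k + 1)`, by the previous coefficients and the value of the function at `y`. -/
lemma abs_sub_sum_range_succ_le {a : ℕ → ℝ} {F : ℝ → ℝ} (ha : ∀ i, 0 ≤ a i)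
    (hF : ∀ y, 0 ≤ y → y ≤ 1 → HasSum (fun i => a i * y ^ i) (F y)) (hF1 : F 1 ≤ 1) (k : ℕ)
    {y : ℝ} (hy0 : 0 ≤ y) (hy1 : y ≤ 1) :
    |F y - ∑ i ∈ range (k + 1), a i * y ^ i| ≤ y ^ (k + 1) := by
  have hy := (hasSum_nat_add_iff' (k + 1)).2 (hF y hy0 hy1)
  have h1 := (hasSum_nat_add_iff' (k + 1)).2 (hF 1 zero_le_one le_rfl)
  have hnn : 0 ≤ F y - ∑ i ∈ range (k + 1), a i * y ^ i :=
    hy.nonneg fun i => mul_nonneg (ha _) (by positivity)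
  have hle := hasSum_le (fun i => ?_) hy (h1.mul_left (y ^ (k + 1)))
  · rw [abs_of_nonneg hnn]
    refine hle.trans (mul_le_of_le_one_right (by positivity) ?_)
    have : 0 ≤ ∑ i ∈ range (k + 1), a i * 1 ^ i := sum_nonneg fun i _ => by simpa using ha i
    linarith
  · rw [one_pow, mul_one, pow_add, mul_comm, mul_assoc]
    refine mul_le_of_le_one_left ?_ (pow_le_one₀ hy0 hy1)
    exact mul_nonneg (by positivity) (ha _)

/-- Pointwise convergence of probability generating functions implies convergence of the
coefficients. -/
lemma tendsto_coeff_of_tendsto_genFun {p : ℕ → ℕ → ℝ} {q : ℕ → ℝ} {F : ℕ → ℝ → ℝ} {G : ℝ → ℝ}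
    (hp : ∀ n i, 0 ≤ p n i) (hq : ∀ i, 0 ≤ q i)
    (hF : ∀ n y, 0 ≤ y → y ≤ 1 → HasSum (fun i => p n i * y ^ i) (F n y))
    (hG : ∀ y, 0 ≤ y → y ≤ 1 → HasSum (fun i => q i * y ^ i) (G y))
    (hF1 : ∀ n, F n 1 ≤ 1) (hG1 : G 1 ≤ 1)
    (h : ∀ y, 0 ≤ y → y ≤ 1 → Filter.Tendsto (fun n => F n y) Filter.atTop (nhds (G y)))
    (k : ℕ) : Filter.Tendsto (fun n => p n k) Filter.atTop (nhds (q k)) := by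
  induction k using Nat.strong_induction_on with
  | _ k ih =>
    rw [Metric.tendsto_nhds]
    intro ε hε
    obtain ⟨y, hy0, hy1, hyε⟩ : ∃ y : ℝ, 0 < y ∧ y ≤ 1 ∧ 2 * y ≤ ε / 2 :=
      ⟨min 1 (ε / 4), by positivity, min_le_left _ _, by linarith [min_le_right 1 (ε / 4)]⟩
    have hyk : 0 < y ^ k := by positivity
    have hlim : Filter.Tendsto (fun n => F n y - ∑ i ∈ range k, p n i * y ^ i) Filter.atTop
        (nhds (G y - ∑ i ∈ range k, q i * y ^ i)) :=
      (h y hy0.le hy1).sub (tendsto_finsetSum _ fun i hi => (ih i (mem_range.1 hi)).mul_const _)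
    filter_upwards [Metric.tendsto_nhds.1 hlim (ε / 2 * y ^ k) (by positivity)] with n hn
    have hpn := abs_sub_sum_range_succ_le (hp n) (hF n) (hF1 n) k hy0.le hy1
    have hqn := abs_sub_sum_range_succ_le hq hG hG1 k hy0.le hy1
    rw [sum_range_succ, pow_succ] at hpn hqn
    rw [Real.dist_eq] at hn ⊢
    refine lt_of_mul_lt_mul_right ?_ hyk.le
    rw [← abs_of_pos hyk, ← abs_mul, abs_of_pos hyk]
    have := mul_le_mul_of_nonneg_left hyε hyk.le
    rw [abs_le] at hpn hqn
    rw [abs_lt] at hn ⊢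
    constructor <;> nlinarith

lemma hasSum_poisson (y : ℝ) :
    HasSum (fun i : ℕ => Real.exp (-1) / (i.factorial : ℝ) * y ^ i) (Real.exp (y - 1)) := by
  have h := (NormedSpace.expSeries_div_hasSum_exp y).mul_left (Real.exp (-1))
  rw [← Real.exp_eq_exp_ℝ, ← Real.exp_add, neg_add_eq_sub] at h
  refine h.congr_fun fun i => ?_
  ring

/-- The distribution of the number of nonempty boxes on the third main diagonal. -/
noncomputable def diagProb (α β : ℝ) (n k : ℕ) : ℝ :=
  (∑ S ∈ (tableaux n).filter (thirdDiag n 0 · = k), stairWt α β S) / stairZ n α β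

lemma hasSum_diagProb (α β : ℝ) (n : ℕ) (y : ℝ) :
    HasSum (fun k => diagProb α β n k * y ^ k) (pgf α β y n 1) := by
  have h : HasSum (fun k => ∑ S ∈ tableaux n,
      if k = thirdDiag n 0 S then stairWt α β S * y ^ thirdDiag n 0 S else 0)
      (∑ S ∈ tableaux n, stairWt α β S * y ^ thirdDiag n 0 S) :=
    hasSum_sum fun S _ => hasSum_ite_eq _ _
  have h' := h.div_const (stairZ n α β)
  have e : pgf α β y n 1 =
      (∑ S ∈ tableaux n, stairWt α β S * y ^ thirdDiag n 0 S) / stairZ n α β := by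
    simp [pgf, genFun, stairZ_eq]
  rw [e]
  refine h'.congr_fun fun k => ?_
  rw [diagProb, div_mul_eq_mul_div, sum_mul, sum_filter]
  congr 1
  exact sum_congr rfl fun S _ => by
    by_cases hk : thirdDiag n 0 S = k
    · rw [if_pos hk, if_pos hk.symm, hk]
    · rw [if_neg hk, if_neg (Ne.symm hk)]

lemma stairP_thirdDiag (α β : ℝ) (n k : ℕ) :
    stairP n α β (fun S => thirdDiag n 0 S = k) = diagProb α β n k := by
  rw [stairP, finsum_isStaircase, diagProb]
  congr!

lemma tendsto_diagProb {α β : ℝ} (hα : 0 < α) (hβ : 0 < β) (k : ℕ) :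
    Filter.Tendsto (fun n => diagProb α β n k) Filter.atTop
      (nhds (Real.exp (-1) / (k.factorial : ℝ))) := by
  refine tendsto_coeff_of_tendsto_genFun (F := fun n y => pgf α β y n 1)
    (q := fun i => Real.exp (-1) / (i.factorial : ℝ)) (fun n i => ?_) (fun i => by positivity)
    (fun n y _ _ => hasSum_diagProb α β n y) (fun y _ _ => hasSum_poisson y) (fun n => ?_) (by simp)
    (fun y hy0 hy1 => tendsto_pgf hα hβ hy0 hy1) k
  · refine div_nonneg (sum_nonneg fun S _ => stairWt_nonneg hα hβ S) ?_
    rw [stairZ_eq]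
    exact sum_nonneg fun S _ => stairWt_nonneg hα hβ S
  · exact (le_abs_self _).trans (abs_pgf_le_one hα hβ zero_le_one le_rfl one_pos n)

end Staircase

/-- The number `X_n^{(3)}` of nonempty boxes on the third main diagonal converges in
distribution to `Pois(1)`. -/
theorem nonempty_third_diagonal_poisson
    (α β : ℝ) (hα : 0 < α) (hβ : 0 < β) (k : ℕ) :
    Filter.Tendsto (fun n : ℕ =>
        stairP n α β (fun S =>
          (((Finset.Icc 1 (n - 2)).filter
            (fun j => S (n - j - 1) j ≠ StairSymb.empty)).card) = k))
      Filter.atTop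
      (nhds (Real.exp (-1 : ℝ) / (Nat.factorial k : ℝ))) := by
  refine (Staircase.tendsto_diagProb hα hβ k).congr fun n => ?_
  rw [← Staircase.stairP_thirdDiag]
  congr! 4
end
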